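/- arXiv:2604.21122 — 5 statements merged into one kernel-verified Lean document; each statement's English description precedes it below -/
import Mathlib

section
/- Let k ≥ 3 be an integer and ε ∈ (0,1). Then there exists a constant p_0 = p_0(k,ε) such that the following holds with C_k = 2^{4k}. Let X_1, …, X_k, D ∈ [1, ∞) with D ≤ min(X_1, …, X_k) and δ ∈ (0,1]. Let A_1, …, A_k be finite sets of integers with A_i ⊆ [X_i, 2X_i], and suppose that the number of tuples (a_1, …, a_k) ∈ A_1 × ⋯ × A_k with gcd(a_1, …, a_k) ≥ D is at least δ·∏_{i=1}^k |A_i|. Let 𝒫_small denote the set of primes p ≤ p_0 that divide some element of A_1 ∪ ⋯ ∪ A_k. Then ∏_{i=1}^k |A_i| ≤ C_k^{1 + #𝒫_small} · δ^{-(k + ε/(k-1))/(k-1)} · (∏_{i=1}^k X_i) / D^k. -/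
open Finset

/-- The minimum of a tuple of natural numbers. -/
def minVal {ι : Type*} [Fintype ι] [Nonempty ι] (j : ι → ℕ) : ℕ :=
  univ.inf' univ_nonempty j

section TupleSums

variable {ι : Type*} [Fintype ι] [Nonempty ι]

lemma minVal_le (j : ι → ℕ) (i : ι) : minVal j ≤ j i :=
  inf'_le _ (mem_univ i)

lemma exists_eq_minVal (j : ι → ℕ) : ∃ i, j i = minVal j := by
  obtain ⟨i, -, hi⟩ := exists_mem_eq_inf' (s := univ) univ_nonempty j
  exact ⟨i, hi.symm⟩

lemma prod_rpow_le_mul_mean {θ : ℝ} (hθ : 1 ≤ Fintype.card ι * θ) {z : ι → ℝ}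
    (hz : ∀ i, 0 ≤ z i) :
    ∏ i, z i ^ θ ≤ (∏ i, z i ^ ((Fintype.card ι * θ - 1) / Fintype.card ι)) *
      ∑ i, (Fintype.card ι : ℝ)⁻¹ * z i := by
  have hk : (0 : ℝ) < Fintype.card ι := by exact_mod_cast Fintype.card_pos
  have h1 : ∀ i, z i ^ θ = z i ^ ((Fintype.card ι * θ - 1) / Fintype.card ι) *
      z i ^ ((Fintype.card ι : ℝ)⁻¹) := by
    intro i
    rw [← Real.rpow_add_of_nonneg (hz i) (div_nonneg (by linarith) hk.le) (by positivity)]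
    congr 1
    field_simp
    ring
  simp_rw [h1, prod_mul_distrib]
  refine mul_le_mul_of_nonneg_left ?_ (prod_nonneg fun i _ => Real.rpow_nonneg (hz i) _)
  refine Real.geom_mean_le_arith_mean_weighted univ _ z (fun _ _ => by positivity) ?_
    (fun i _ => hz i)
  simp [hk.ne']

lemma sum_mean_shift_le {β : ι → ℕ → ℝ} {B : ℝ}
    (hβB : ∀ i, ∀ T : Finset ℕ, ∑ m ∈ T, β i m ≤ B) (T : Finset ℕ) (d : ι → ℕ) :
    ∑ m ∈ T, ∑ i, (Fintype.card ι : ℝ)⁻¹ * β i (m + d i) ≤ B := by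
  have hk : (0 : ℝ) < Fintype.card ι := by exact_mod_cast Fintype.card_pos
  rw [sum_comm]
  calc ∑ i, ∑ m ∈ T, (Fintype.card ι : ℝ)⁻¹ * β i (m + d i)
      ≤ ∑ _i : ι, (Fintype.card ι : ℝ)⁻¹ * B := by
        refine sum_le_sum fun i _ => ?_
        rw [← mul_sum]
        refine mul_le_mul_of_nonneg_left ?_ (by positivity)
        have := hβB i (T.map (addRightEmbedding (d i)))
        simpa [sum_map] using this
    _ = B := by simp [hk.ne']

lemma sum_prod_rpow_shift_le {θ : ℝ} (hθ : 1 ≤ Fintype.card ι * θ) {β : ι → ℕ → ℝ} {y B : ℝ}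
    (hβ : ∀ i m, 0 ≤ β i m) (hβy : ∀ i m, β i m ≤ y)
    (hβB : ∀ i, ∀ T : Finset ℕ, ∑ m ∈ T, β i m ≤ B) (T : Finset ℕ) (d : ι → ℕ) :
    ∑ m ∈ T, ∏ i, β i (m + d i) ^ θ ≤ y ^ (Fintype.card ι * θ - 1) * B := by
  have hk : (0 : ℝ) < Fintype.card ι := by exact_mod_cast Fintype.card_pos
  have hy : 0 ≤ y := (hβ (Classical.arbitrary ι) 0).trans (hβy _ _)
  calc ∑ m ∈ T, ∏ i, β i (m + d i) ^ θ
      ≤ ∑ m ∈ T, y ^ (Fintype.card ι * θ - 1) *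
          ∑ i, (Fintype.card ι : ℝ)⁻¹ * β i (m + d i) := by
        refine sum_le_sum fun m _ => ?_
        refine (prod_rpow_le_mul_mean hθ fun i => hβ i _).trans ?_
        refine mul_le_mul_of_nonneg_right ?_
          (sum_nonneg fun i _ => mul_nonneg (by positivity) (hβ _ _))
        calc ∏ i, β i (m + d i) ^ ((Fintype.card ι * θ - 1) / Fintype.card ι)
            ≤ ∏ _i : ι, y ^ ((Fintype.card ι * θ - 1) / Fintype.card ι) :=
              prod_le_prod (fun i _ => Real.rpow_nonneg (hβ _ _) _) fun i _ =>
                Real.rpow_le_rpow (hβ _ _) (hβy _ _) (div_nonneg (by linarith) hk.le)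
          _ = y ^ (Fintype.card ι * θ - 1) := by
              rw [prod_const, card_univ, ← Real.rpow_mul_natCast hy, div_mul_cancel₀ _ hk.ne']
    _ ≤ _ := by
        rw [← mul_sum]
        exact mul_le_mul_of_nonneg_left (sum_mean_shift_le hβB T d) (Real.rpow_nonneg hy _)

lemma sum_le_of_le_prod_shift [DecidableEq ι] {θ : ℝ} (hθ : 1 ≤ Fintype.card ι * θ)
    {β : ι → ℕ → ℝ} {y B G : ℝ}
    (hβ : ∀ i m, 0 ≤ β i m) (hβy : ∀ i m, β i m ≤ y)
    (hβB : ∀ i, ∀ T : Finset ℕ, ∑ m ∈ T, β i m ≤ B)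
    {g : ℕ → ℝ} (hg : ∀ d, 0 ≤ g d) {L : ℕ} (hG : ∑ d ∈ range L, g d ≤ G)
    {J : Finset (ι → ℕ)} (hJ : J ⊆ Fintype.piFinset fun _ => range L) {f : (ι → ℕ) → ℝ}
    (hf : ∀ j ∈ J, f j ≤ ∏ i, (β i (j i) ^ θ * g (j i - minVal j))) :
    ∑ j ∈ J, f j ≤ G ^ Fintype.card ι * (y ^ (Fintype.card ι * θ - 1) * B) := by
  have hy : 0 ≤ y := (hβ (Classical.arbitrary ι) 0).trans (hβy _ _)
  have hB : 0 ≤ B := by simpa using hβB (Classical.arbitrary ι) ∅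
  set P := Fintype.piFinset fun _ : ι => range L with hP
  let F : ℕ × (ι → ℕ) → ℝ := fun x => ∏ i, (β i (x.1 + x.2 i) ^ θ * g (x.2 i))
  have hF : ∀ x, 0 ≤ F x := fun x =>
    prod_nonneg fun i _ => mul_nonneg (Real.rpow_nonneg (hβ _ _) _) (hg _)
  let φ : (ι → ℕ) → ℕ × (ι → ℕ) := fun j => (minVal j, fun i => j i - minVal j)
  have hφ : Function.Injective φ := by
    intro j j' h
    simp only [φ, Prod.mk.injEq] at h
    funext i
    have h2 := congrFun h.2 i
    have := minVal_le j i
    have := minVal_le j' i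
    omega
  calc ∑ j ∈ J, f j ≤ ∑ j ∈ J, F (φ j) := by
        refine sum_le_sum fun j hj => (hf j hj).trans (le_of_eq ?_)
        refine prod_congr rfl fun i _ => ?_
        simp only [φ]
        rw [Nat.add_sub_cancel' (minVal_le j i)]
    _ = ∑ x ∈ J.image φ, F x := (sum_image fun a _ b _ h => hφ h).symm
    _ ≤ ∑ x ∈ range L ×ˢ P, F x := by
        refine sum_le_sum_of_subset_of_nonneg ?_ fun x _ _ => hF x
        intro x hx
        obtain ⟨j, hj, rfl⟩ := mem_image.1 hx
        have hj' := hJ hj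
        simp only [hP, Fintype.mem_piFinset, mem_range] at hj'
        simp only [φ, mem_product, mem_range, hP, Fintype.mem_piFinset]
        exact ⟨(minVal_le j (Classical.arbitrary ι)).trans_lt (hj' _), fun i =>
          (Nat.sub_le _ _).trans_lt (hj' i)⟩
    _ = ∑ d ∈ P, (∏ i, g (d i)) * ∑ m ∈ range L, ∏ i, β i (m + d i) ^ θ := by
        rw [sum_product_right]
        refine sum_congr rfl fun d _ => ?_
        rw [mul_sum]
        refine sum_congr rfl fun m _ => ?_
        simp only [F]
        rw [prod_mul_distrib, mul_comm]
    _ ≤ ∑ d ∈ P, (∏ i, g (d i)) * (y ^ (Fintype.card ι * θ - 1) * B) :=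
        sum_le_sum fun d _ => mul_le_mul_of_nonneg_left
          (sum_prod_rpow_shift_le hθ hβ hβy hβB _ d) (prod_nonneg fun i _ => hg _)
    _ = (∑ d ∈ range L, g d) ^ Fintype.card ι * (y ^ (Fintype.card ι * θ - 1) * B) := by
        rw [← sum_mul, hP, sum_prod_piFinset (range L) fun _ d => g d]
        simp
    _ ≤ _ := by
        refine mul_le_mul_of_nonneg_right ?_ (mul_nonneg (Real.rpow_nonneg hy _) hB)
        exact pow_le_pow_left₀ (sum_nonneg fun d _ => hg d) hG _

end TupleSums

lemma sum_range_pow_le {q : ℝ} (hq0 : 0 ≤ q) (hq1 : q < 1) (L : ℕ) :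
    ∑ d ∈ range L, q ^ d ≤ (1 - q)⁻¹ := by
  rw [← tsum_geometric_of_lt_one hq0 hq1]
  exact (summable_geometric_of_lt_one hq0 hq1).sum_le_tsum _ fun _ _ => by positivity

lemma sum_range_pow_pred_le {q : ℝ} (hq0 : 0 ≤ q) (hq1 : q < 1) (L : ℕ) :
    ∑ d ∈ range L, q ^ (d - 1) ≤ 1 + (1 - q)⁻¹ := by
  cases L with
  | zero =>
    have : (0 : ℝ) < 1 - q := by linarith
    simp only [range_zero, sum_empty]
    positivity
  | succ L =>
    rw [sum_range_succ']
    have := sum_range_pow_le hq0 hq1 L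
    simp only [Nat.add_sub_cancel, zero_le, Nat.sub_eq_zero_of_le, pow_zero]
    linarith

lemma one_add_pow_le {b : ℝ} (hb0 : 0 ≤ b) (hb1 : b ≤ 1) (m : ℕ) :
    (1 + b) ^ m ≤ 1 + (2 ^ m - 1) * b := by
  induction m with
  | zero => simp
  | succ m ih =>
    have h2 : (1 : ℝ) ≤ 2 ^ m := one_le_pow₀ (by norm_num)
    rw [pow_succ, pow_succ]
    nlinarith [mul_le_mul_of_nonneg_right ih (by linarith : 0 ≤ 1 + b),
      mul_nonneg (mul_nonneg (sub_nonneg.2 h2) hb0) (sub_nonneg.2 hb1)]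

lemma sub_prob_le_one {ι : Type*} {α : ι → ℕ → ℝ}
    (hα1 : ∀ i, ∀ T : Finset ℕ, ∑ m ∈ T, α i m ≤ 1) (i : ι) (m : ℕ) :
    α i m ≤ 1 := by simpa using hα1 i {m}

lemma sub_prob_le_one_sub {ι : Type*} {α : ι → ℕ → ℝ}
    (hα1 : ∀ i, ∀ T : Finset ℕ, ∑ m ∈ T, α i m ≤ 1) (i : ι) {m n : ℕ}
    (h : m ≠ n) : α i m ≤ 1 - α i n := by
  have := hα1 i {m, n}
  rw [sum_pair h] at this
  linarith

section Concentration

open Filter Topology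

variable {ι : Type*} [Fintype ι] [Nonempty ι] [DecidableEq ι] {θ : ℝ} {α : ι → ℕ → ℝ} {q : ℝ}
  {L : ℕ} {w : (ι → ℕ) → ℝ}

lemma exists_concentrated (hθ : 1 ≤ Fintype.card ι * θ)
    (hα0 : ∀ i m, 0 ≤ α i m) (hα1 : ∀ i, ∀ T : Finset ℕ, ∑ m ∈ T, α i m ≤ 1)
    (hq0 : 0 ≤ q) (hq : q ≤ 1 / 4) {ξ : ℝ} (hξ1 : ξ ≤ 1)
    (hξq : (1 - ξ) ^ ((Fintype.card ι * θ - 1) / Fintype.card ι) +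
      2 ^ Fintype.card ι * √q < 1)
    (hw1 : 1 ≤ ∑ j ∈ Fintype.piFinset fun _ : ι => range L, w j)
    (hw : ∀ j ∈ Fintype.piFinset fun _ : ι => range L,
      w j ≤ ∏ i, (α i (j i) ^ θ * q ^ (j i - minVal j))) :
    ∃ n, ∀ i, 1 - ξ ≤ α i n := by
  by_contra! hcon
  have hk : (0 : ℝ) < Fintype.card ι := by exact_mod_cast Fintype.card_pos
  have hsq : √q ≤ 1 / 2 := by
    rw [Real.sqrt_le_left (by norm_num)]
    linarith
  have hsq0 : 0 ≤ √q := Real.sqrt_nonneg q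
  set P := Fintype.piFinset fun _ : ι => range L with hP
  have hdiag : ∑ j ∈ P.filter (fun j => ∀ i, j i = minVal j), w j ≤
      (1 - ξ) ^ ((Fintype.card ι * θ - 1) / Fintype.card ι) := by
    let F : ℕ → ℝ := fun m => ∏ i, α i m ^ θ
    have hF : ∀ m, F m ≤ (1 - ξ) ^ ((Fintype.card ι * θ - 1) / Fintype.card ι) *
        ∑ i, (Fintype.card ι : ℝ)⁻¹ * α i m := by
      intro m
      refine (prod_rpow_le_mul_mean hθ fun i => hα0 i m).trans ?_
      refine mul_le_mul_of_nonneg_right ?_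
        (sum_nonneg fun i _ => mul_nonneg (by positivity) (hα0 _ _))
      obtain ⟨i₀, hi₀⟩ := hcon m
      have he : 0 ≤ (Fintype.card ι * θ - 1) / Fintype.card ι :=
        div_nonneg (by linarith) hk.le
      rw [← mul_prod_erase univ _ (mem_univ i₀), ← mul_one ((1 - ξ) ^ _)]
      refine mul_le_mul (Real.rpow_le_rpow (hα0 _ _) hi₀.le he) ?_
        (prod_nonneg fun i _ => Real.rpow_nonneg (hα0 _ _) _)
        (Real.rpow_nonneg (by linarith) _)
      exact prod_le_one (fun i _ => Real.rpow_nonneg (hα0 _ _) _) fun i _ =>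
        Real.rpow_le_one (hα0 _ _) (sub_prob_le_one hα1 _ _) he
    calc ∑ j ∈ P.filter (fun j => ∀ i, j i = minVal j), w j
        ≤ ∑ j ∈ P.filter (fun j => ∀ i, j i = minVal j), F (minVal j) := by
          refine sum_le_sum fun j hj => ?_
          obtain ⟨hjP, hj⟩ := mem_filter.1 hj
          refine (hw j hjP).trans (le_of_eq ?_)
          exact prod_congr rfl fun i _ => by rw [hj i]; simp
      _ = ∑ m ∈ (P.filter (fun j => ∀ i, j i = minVal j)).image minVal, F m := by
          rw [sum_image]
          intro a ha b hb h
          funext i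
          have ha := (mem_filter.1 ha).2 i
          have hb := (mem_filter.1 hb).2 i
          omega
      _ ≤ ∑ m ∈ (P.filter (fun j => ∀ i, j i = minVal j)).image minVal,
            (1 - ξ) ^ ((Fintype.card ι * θ - 1) / Fintype.card ι) *
              ∑ i, (Fintype.card ι : ℝ)⁻¹ * α i (m + 0) := sum_le_sum fun m _ => hF m
      _ ≤ _ := by
          rw [← mul_sum]
          exact mul_le_of_le_one_right (Real.rpow_nonneg (by linarith) _)
            (sum_mean_shift_le hα1 _ fun _ => 0)
  have hoff : ∑ j ∈ P.filter (fun j => ¬ ∀ i, j i = minVal j), w j ≤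
      2 ^ Fintype.card ι * √q := by
    have h := sum_le_of_le_prod_shift (J := P.filter (fun j => ¬ ∀ i, j i = minVal j))
      (f := fun j => ∏ i, (α i (j i) ^ θ * (√q) ^ (j i - minVal j))) (y := 1) (B := 1) (G := 2)
      (L := L) (g := fun d => (√q) ^ d) hθ hα0 (sub_prob_le_one hα1) hα1 (fun d => by positivity)
      ((sum_range_pow_le hsq0 (by linarith) L).trans (by
        rw [inv_le_comm₀ (by linarith) (by norm_num)]; linarith))
      (filter_subset _ _) (fun j _ => le_rfl)
    rw [Real.one_rpow, mul_one, mul_one] at h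
    refine le_trans ?_ (mul_le_mul_of_nonneg_right h hsq0)
    rw [sum_mul]
    refine sum_le_sum fun j hj => ?_
    obtain ⟨hjP, hj⟩ := mem_filter.1 hj
    refine (hw j hjP).trans ?_
    push Not at hj
    obtain ⟨i₀, hi₀⟩ := hj
    have hpos : 1 ≤ ∑ i, (j i - minVal j) := by
      have := minVal_le j i₀
      exact le_trans (by omega : 1 ≤ j i₀ - minVal j)
        (single_le_sum (f := fun i => j i - minVal j) (fun _ _ => Nat.zero_le _) (mem_univ i₀))
    simp only [prod_mul_distrib]
    rw [mul_assoc]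
    refine mul_le_mul_of_nonneg_left ?_ (prod_nonneg fun i _ => Real.rpow_nonneg (hα0 _ _) _)
    rw [prod_pow_eq_pow_sum, prod_pow_eq_pow_sum, ← pow_succ]
    conv_lhs => rw [← Real.sq_sqrt hq0, ← pow_mul]
    exact pow_le_pow_of_le_one hsq0 (by linarith) (by omega)
  have := sum_filter_add_sum_filter_not P (fun j => ∀ i, j i = minVal j) w
  linarith

lemma sum_minVal_ne_le (hθ : 1 ≤ Fintype.card ι * θ) (hθ0 : 0 ≤ θ) (hθ2 : θ ≤ 1 / 2)
    (hα0 : ∀ i m, 0 ≤ α i m) (hα1 : ∀ i, ∀ T : Finset ℕ, ∑ m ∈ T, α i m ≤ 1)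
    {t y : ℝ} (ht0 : 0 < t) (ht1 : t ≤ 1) (hq : t ^ (1 - θ) ≤ 1 / 4) (hty : t ≤ y) {n : ℕ}
    (hn : ∀ i, 1 - α i n ≤ y)
    (hw : ∀ j ∈ Fintype.piFinset fun _ : ι => range L,
      w j ≤ ∏ i, (α i (j i) ^ θ * (t ^ (1 - θ)) ^ (j i - minVal j))) :
    ∑ j ∈ (Fintype.piFinset fun _ : ι => range L).filter (fun j => minVal j ≠ n), w j ≤
      3 ^ Fintype.card ι * (y ^ (Fintype.card ι * θ - 1) * (2 * y)) := by
  set q := t ^ (1 - θ) with hqdef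
  have hq0 : 0 ≤ q := Real.rpow_nonneg ht0.le _
  let β : ι → ℕ → ℝ := fun i m => if m = n then t else α i m
  have hβ0 : ∀ i m, 0 ≤ β i m := by
    intro i m
    simp only [β]
    split_ifs
    exacts [ht0.le, hα0 _ _]
  refine sum_le_of_le_prod_shift (L := L) (β := β) (g := fun d => q ^ (d - 1)) hθ hβ0 ?_ ?_
    (fun d => by positivity)
    ((sum_range_pow_pred_le hq0 (by linarith) L).trans ?_) (filter_subset _ _) ?_
  · intro i m
    simp only [β]
    split_ifs with h
    exacts [hty, (sub_prob_le_one_sub hα1 i h).trans (hn i)]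
  · intro i T
    have h1 : ∑ m ∈ T, β i m ≤ ∑ m ∈ insert n (T.erase n), β i m := by
      refine sum_le_sum_of_subset_of_nonneg ?_ fun m _ _ => hβ0 i m
      intro m hm
      by_cases h : m = n <;> simp [h, hm]
    rw [sum_insert (notMem_erase _ _)] at h1
    have h2 : ∑ m ∈ T.erase n, β i m = ∑ m ∈ T.erase n, α i m :=
      sum_congr rfl fun m hm => by simp [β, ne_of_mem_erase hm]
    have h3 := hα1 i (insert n (T.erase n))
    rw [sum_insert (notMem_erase _ _)] at h3
    have h4 : β i n = t := by simp [β]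
    have := hn i
    linarith
  · have : (1 - q)⁻¹ ≤ 2 := by
      rw [inv_le_comm₀ (by linarith) (by norm_num)]; linarith
    linarith
  · intro j hj
    obtain ⟨hjP, hj⟩ := mem_filter.1 hj
    refine (hw j hjP).trans ?_
    refine prod_le_prod (fun i _ => mul_nonneg (Real.rpow_nonneg (hα0 _ _) _) (by positivity))
      fun i _ => ?_
    simp only [β]
    split_ifs with h
    · have hlt : j i - minVal j = (j i - minVal j - 1) + 1 := by
        have := minVal_le j i
        omega
      rw [hlt, pow_succ', Nat.add_sub_cancel, ← mul_assoc]
      refine mul_le_mul_of_nonneg_right ?_ (by positivity)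
      calc α i (j i) ^ θ * q ≤ 1 * q := mul_le_mul_of_nonneg_right
            (Real.rpow_le_one (hα0 _ _) (sub_prob_le_one hα1 _ _) hθ0) hq0
        _ ≤ t ^ θ := by
            rw [one_mul]
            exact Real.rpow_le_rpow_of_exponent_ge ht0 ht1 (by linarith)
    · exact mul_le_mul_of_nonneg_left
        (pow_le_pow_of_le_one hq0 (by linarith) (Nat.sub_le _ _))
        (Real.rpow_nonneg (hα0 _ _) _)

lemma sum_minVal_eq_le (hθ0 : 0 ≤ θ) (hθ2 : θ ≤ 1 / 2)
    (hα0 : ∀ i m, 0 ≤ α i m) (hα1 : ∀ i, ∀ T : Finset ℕ, ∑ m ∈ T, α i m ≤ 1)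
    {y : ℝ} (hq0 : 0 ≤ q) (hq : q ≤ 1 / 4) (hy0 : 0 ≤ y) (hy1 : y ≤ 1) {n : ℕ}
    (hn : ∀ i, 1 - α i n ≤ y) {i₀ : ι} (hi₀ : 1 - α i₀ n = y)
    (hw : ∀ j ∈ Fintype.piFinset fun _ : ι => range L,
      w j ≤ ∏ i, (α i (j i) ^ θ * q ^ (j i - minVal j))) :
    ∑ j ∈ (Fintype.piFinset fun _ : ι => range L).filter (fun j => minVal j = n), w j ≤
      1 - θ * y + 4 * 2 ^ Fintype.card ι * (y ^ θ * q) := by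
  set b : ℝ := 4 / 3 * (y ^ θ * q) with hb
  have hyθ : y ^ θ ≤ 1 := Real.rpow_le_one hy0 hy1 hθ0
  have hyθ0 : 0 ≤ y ^ θ := Real.rpow_nonneg hy0 _
  have hb0 : 0 ≤ b := by positivity
  have hb1 : b ≤ 1 := by
    rw [hb]
    nlinarith
  have hrow : ∀ i, ∑ m ∈ Ico n L, α i m ^ θ * q ^ (m - n) ≤ α i n ^ θ + b := by
    intro i
    calc ∑ m ∈ Ico n L, α i m ^ θ * q ^ (m - n)
        ≤ ∑ m ∈ Ico n (n + (L + 1)), α i m ^ θ * q ^ (m - n) :=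
          sum_le_sum_of_subset_of_nonneg (Ico_subset_Ico le_rfl (by omega)) fun m _ _ =>
            mul_nonneg (Real.rpow_nonneg (hα0 _ _) _) (by positivity)
      _ = ∑ d ∈ range L, α i (n + (d + 1)) ^ θ * q ^ (d + 1) + α i n ^ θ := by
          rw [sum_Ico_eq_sum_range, Nat.add_sub_cancel_left, sum_range_succ']
          simp
      _ ≤ ∑ d ∈ range L, y ^ θ * q * q ^ d + α i n ^ θ := by
          refine add_le_add_left (sum_le_sum fun d _ => ?_) _
          rw [pow_succ', ← mul_assoc]
          have := Real.rpow_le_rpow (hα0 i (n + (d + 1)))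
            ((sub_prob_le_one_sub hα1 i (by omega)).trans (hn i)) hθ0
          gcongr
      _ ≤ α i n ^ θ + b := by
          rw [← mul_sum, add_comm, hb, mul_comm (4 / 3)]
          gcongr
          refine (sum_range_pow_le hq0 (by linarith) L).trans ?_
          rw [inv_le_comm₀ (by linarith) (by norm_num)]
          linarith
  have hsum : ∑ j ∈ (Fintype.piFinset fun _ : ι => range L).filter (fun j => minVal j = n), w j
      ≤ ∏ i, (α i n ^ θ + b) := by
    calc _ ≤ ∑ j ∈ (Fintype.piFinset fun _ : ι => range L).filter (fun j => minVal j = n),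
            ∏ i, (α i (j i) ^ θ * q ^ (j i - n)) := by
          refine sum_le_sum fun j hj => ?_
          obtain ⟨hjP, rfl⟩ := mem_filter.1 hj
          exact hw j hjP
      _ ≤ ∑ j ∈ Fintype.piFinset fun _ : ι => Ico n L,
            ∏ i, (α i (j i) ^ θ * q ^ (j i - n)) := by
          refine sum_le_sum_of_subset_of_nonneg ?_ fun j _ _ =>
            prod_nonneg fun i _ => mul_nonneg (Real.rpow_nonneg (hα0 _ _) _) (by positivity)
          intro j hj
          obtain ⟨hjP, rfl⟩ := mem_filter.1 hj
          simp only [Fintype.mem_piFinset, mem_range, mem_Ico] at hjP ⊢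
          exact fun i => ⟨minVal_le j i, hjP i⟩
      _ = ∏ i, ∑ m ∈ Ico n L, α i m ^ θ * q ^ (m - n) :=
          sum_prod_piFinset (Ico n L) fun i m => α i m ^ θ * q ^ (m - n)
      _ ≤ _ := prod_le_prod (fun i _ => sum_nonneg fun m _ =>
          mul_nonneg (Real.rpow_nonneg (hα0 _ _) _) (by positivity)) fun i _ => hrow i
  have hmain : α i₀ n ^ θ ≤ 1 - θ * y := by
    have h := rpow_one_add_le_one_add_mul_self (s := -y) (p := θ) (by linarith) hθ0 (by linarith)
    rw [show α i₀ n = 1 + -y by linarith]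
    linarith
  have hprod : ∏ i, (α i n ^ θ + b) ≤ (1 - θ * y + b) * (1 + 2 ^ Fintype.card ι * b) := by
    rw [← mul_prod_erase univ _ (mem_univ i₀)]
    have hpos : ∀ i, 0 ≤ α i n ^ θ + b := fun i => add_nonneg (Real.rpow_nonneg (hα0 _ _) _) hb0
    refine mul_le_mul (by linarith) ?_ (prod_nonneg fun i _ => hpos i)
      (by nlinarith)
    calc ∏ i ∈ univ.erase i₀, (α i n ^ θ + b) ≤ ∏ _i ∈ univ.erase i₀, (1 + b) :=
          prod_le_prod (fun i _ => hpos i) fun i _ => by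
            have := Real.rpow_le_one (hα0 i n) (sub_prob_le_one hα1 i n) hθ0
            linarith
      _ = (1 + b) ^ (univ.erase i₀).card := by rw [prod_const]
      _ ≤ (1 + b) ^ Fintype.card ι := pow_le_pow_right₀ (by linarith) (card_le_univ _)
      _ ≤ 1 + (2 ^ Fintype.card ι - 1) * b := one_add_pow_le hb0 hb1 _
      _ ≤ _ := by linarith
  have h2 : (1 : ℝ) ≤ 2 ^ Fintype.card ι := one_le_pow₀ (by norm_num)
  refine (hsum.trans hprod).trans ?_
  have h3 : 4 * 2 ^ Fintype.card ι * (y ^ θ * q) = 3 * 2 ^ Fintype.card ι * b := by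
    rw [hb]; ring
  rw [h3]
  have h4 : 0 ≤ θ * y := by positivity
  nlinarith [mul_nonneg (by linarith : (0:ℝ) ≤ 2 ^ Fintype.card ι - 1) hb0,
    mul_nonneg (mul_nonneg h4 (by linarith : (0:ℝ) ≤ 2 ^ Fintype.card ι)) hb0,
    mul_nonneg (mul_nonneg (by linarith : (0:ℝ) ≤ 2 ^ Fintype.card ι) hb0) (sub_nonneg.2 hb1)]

omit [Nonempty ι] [DecidableEq ι] in
lemma eventually_concentration_small (hθ : 1 < Fintype.card ι * θ) (hθ0 : 0 < θ)
    (hθ1 : θ < 1) :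
    ∃ ξ : ℝ, 0 < ξ ∧ ξ ≤ 1 ∧
      3 ^ Fintype.card ι * (ξ ^ (Fintype.card ι * θ - 1) * 2) ≤ θ / 2 ∧
      ∀ᶠ t in 𝓝[>] (0 : ℝ), t ≤ ξ ∧ t ^ (1 - θ) ≤ 1 / 4 ∧
        (1 - ξ) ^ ((Fintype.card ι * θ - 1) / Fintype.card ι) +
          2 ^ Fintype.card ι * √(t ^ (1 - θ)) < 1 := by
  have hη : 0 < Fintype.card ι * θ - 1 := by linarith
  have hk : (0 : ℝ) < Fintype.card ι := by
    by_contra! h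
    nlinarith
  have hto : ∀ {e : ℝ}, 0 < e → Tendsto (fun t : ℝ => t ^ e) (𝓝[>] 0) (𝓝 0) := by
    intro e he
    have := (Real.continuousAt_rpow_const 0 e (Or.inr he.le)).tendsto
    rw [Real.zero_rpow he.ne'] at this
    exact this.mono_left nhdsWithin_le_nhds
  have h1 : ∀ᶠ ξ in 𝓝[>] (0 : ℝ),
      3 ^ Fintype.card ι * (ξ ^ (Fintype.card ι * θ - 1) * 2) < θ / 2 := by
    have := ((hto hη).mul_const 2).const_mul ((3 : ℝ) ^ Fintype.card ι)
    rw [zero_mul, mul_zero] at this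
    exact this.eventually_lt_const (by linarith)
  have h2 : ∀ᶠ ξ in 𝓝[>] (0 : ℝ), ξ ≤ 1 :=
    (eventually_le_nhds one_pos).filter_mono nhdsWithin_le_nhds
  obtain ⟨ξ, ⟨hξ, hξ1⟩, hξ0⟩ := ((h1.and h2).and eventually_mem_nhdsWithin).exists
  have hξ0 : 0 < ξ := hξ0
  refine ⟨ξ, hξ0, hξ1, hξ.le, ?_⟩
  have h3 : ∀ᶠ t in 𝓝[>] (0 : ℝ), t ≤ ξ :=
    (eventually_le_nhds hξ0).filter_mono nhdsWithin_le_nhds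
  have h4 : ∀ᶠ t in 𝓝[>] (0 : ℝ), t ^ (1 - θ) ≤ 1 / 4 :=
    (hto (by linarith)).eventually_le_const (by norm_num)
  have h5 : ∀ᶠ t in 𝓝[>] (0 : ℝ), (1 - ξ) ^ ((Fintype.card ι * θ - 1) / Fintype.card ι) +
          2 ^ Fintype.card ι * √(t ^ (1 - θ)) < 1 := by
    have := (((Real.continuous_sqrt.tendsto 0).comp
      (hto (by linarith : 0 < 1 - θ))).const_mul ((2 : ℝ) ^ Fintype.card ι)).const_add
        ((1 - ξ) ^ ((Fintype.card ι * θ - 1) / Fintype.card ι))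
    simp only [Real.sqrt_zero, mul_zero, add_zero] at this
    exact this.eventually_lt_const
      (Real.rpow_lt_one (by linarith) (by linarith) (div_pos hη hk))
  filter_upwards [h3, h4, h5] with t h3 h4 h5 using ⟨h3, h4, h5⟩

/-- If a probability weight `w` on tuples is dominated by a product of sub-probability weights with
decay away from the diagonal, then the minimum of a tuple is nearly constant. -/
lemma eventually_exists_sum_minVal_ne_le (hθ : 1 < Fintype.card ι * θ) (hθ0 : 0 < θ)
    (hθ2 : θ ≤ 1 / 2) :
    ∃ c : ℝ, ∀ᶠ t in 𝓝[>] (0 : ℝ), ∀ (α : ι → ℕ → ℝ) (L : ℕ) (w : (ι → ℕ) → ℝ),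
      (∀ i m, 0 ≤ α i m) → (∀ i, ∀ T : Finset ℕ, ∑ m ∈ T, α i m ≤ 1) →
      1 ≤ ∑ j ∈ Fintype.piFinset fun _ : ι => range L, w j →
      (∀ j ∈ Fintype.piFinset fun _ : ι => range L,
        w j ≤ ∏ i, (α i (j i) ^ θ * (t ^ (1 - θ)) ^ (j i - minVal j))) →
      ∃ n, ∑ j ∈ (Fintype.piFinset fun _ : ι => range L).filter (fun j => minVal j ≠ n), w j ≤
        c * t ^ (Fintype.card ι * θ) := by
  obtain ⟨ξ, hξ0, hξ1, hξ, hev⟩ := eventually_concentration_small hθ hθ0 (by linarith)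
  set C : ℝ := 8 * 2 ^ Fintype.card ι / θ with hC
  have hC1 : 1 ≤ C := by
    rw [hC, one_le_div hθ0]
    have : (1 : ℝ) ≤ 2 ^ Fintype.card ι := one_le_pow₀ (by norm_num)
    linarith
  refine ⟨3 ^ Fintype.card ι * 2 * (C ^ (1 - θ)⁻¹) ^ (Fintype.card ι * θ), ?_⟩
  filter_upwards [hev, eventually_mem_nhdsWithin] with t ⟨htξ, htq, hts⟩ ht0 α L w hα0 hα1 hw1 hw
  have ht0 : 0 < t := ht0
  have hq0 : 0 ≤ t ^ (1 - θ) := Real.rpow_nonneg ht0.le _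
  obtain ⟨n, hn⟩ := exists_concentrated hθ.le hα0 hα1 hq0 htq hξ1 hts hw1 hw
  refine ⟨n, ?_⟩
  set y := max t (univ.sup' univ_nonempty fun i => 1 - α i n) with hy
  have hty : t ≤ y := le_max_left _ _
  have hy0 : 0 < y := ht0.trans_le hty
  have hny : ∀ i, 1 - α i n ≤ y := fun i =>
    (le_sup' (fun i => 1 - α i n) (mem_univ i)).trans (le_max_right _ _)
  have hyξ : y ≤ ξ := max_le htξ (sup'_le _ _ fun i _ => by have := hn i; linarith)
  have hbad := sum_minVal_ne_le hθ.le hθ0.le hθ2 hα0 hα1 ht0 (htξ.trans hξ1) htq hty hny hw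
  have hyC : y ≤ C ^ (1 - θ)⁻¹ * t := by
    rcases max_choice t (univ.sup' univ_nonempty fun i => 1 - α i n) with h | h
    · rw [hy, h]
      exact le_mul_of_one_le_left ht0.le
        (Real.one_le_rpow hC1 (inv_nonneg.2 (by linarith)))
    · obtain ⟨i₀, -, hi₀⟩ := exists_mem_eq_sup' (s := univ) univ_nonempty fun i => 1 - α i n
      have hgood := sum_minVal_eq_le hθ0.le hθ2 hα0 hα1 hq0 htq hy0.le (hyξ.trans hξ1) hny
        (i₀ := i₀) (by rw [← hi₀, hy, h]) hw
      have htot := sum_filter_add_sum_filter_not (Fintype.piFinset fun _ : ι => range L)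
        (fun j => minVal j = n) w
      have hyη : y ^ (Fintype.card ι * θ - 1) ≤ ξ ^ (Fintype.card ι * θ - 1) :=
        Real.rpow_le_rpow hy0.le hyξ (by linarith)
      have h1 : 3 ^ Fintype.card ι * (y ^ (Fintype.card ι * θ - 1) * (2 * y)) ≤ θ / 2 * y := by
        calc _ = 3 ^ Fintype.card ι * (y ^ (Fintype.card ι * θ - 1) * 2) * y := by ring
          _ ≤ 3 ^ Fintype.card ι * (ξ ^ (Fintype.card ι * θ - 1) * 2) * y := by gcongr
          _ ≤ _ := by gcongr
      have h2 : θ / 2 * y ≤ 4 * 2 ^ Fintype.card ι * (y ^ θ * t ^ (1 - θ)) := by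
        simp only [ne_eq] at hbad
        linarith
      have h3 : y = y ^ θ * y ^ (1 - θ) := by
        rw [← Real.rpow_add hy0]; simp
      have hyθ : 0 < y ^ θ := Real.rpow_pos_of_pos hy0 _
      have h4 : y ^ (1 - θ) ≤ C * t ^ (1 - θ) := by
        have h5 : y ^ θ * y ^ (1 - θ) ≤ y ^ θ * (C * t ^ (1 - θ)) := by
          rw [← h3, hC]
          have : y ^ θ * (8 * 2 ^ Fintype.card ι / θ * t ^ (1 - θ)) =
            (4 * 2 ^ Fintype.card ι * (y ^ θ * t ^ (1 - θ))) / (θ / 2) := by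
              field_simp
              ring
          rw [this, le_div_iff₀ (by linarith)]
          linarith
        exact le_of_mul_le_mul_left h5 hyθ
      have hθ1 : (1 - θ) ≠ 0 := by linarith
      have h6 := Real.rpow_le_rpow (Real.rpow_nonneg hy0.le _) h4
        (inv_nonneg.2 (by linarith : 0 ≤ 1 - θ))
      rwa [Real.mul_rpow (by linarith) hq0, Real.rpow_rpow_inv hy0.le hθ1,
        Real.rpow_rpow_inv ht0.le hθ1] at h6
  refine hbad.trans ?_
  calc 3 ^ Fintype.card ι * (y ^ (Fintype.card ι * θ - 1) * (2 * y))
      = 3 ^ Fintype.card ι * 2 * y ^ (Fintype.card ι * θ) := by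
        rw [Real.rpow_sub_one hy0.ne']
        field_simp
    _ ≤ 3 ^ Fintype.card ι * 2 * (C ^ (1 - θ)⁻¹ * t) ^ (Fintype.card ι * θ) := by
        gcongr
    _ = _ := by
        rw [Real.mul_rpow (Real.rpow_nonneg (by linarith) _) ht0.le]
        ring

end Concentration

section Valuations

open Filter Topology

lemma card_le_of_prod_pow_le {V : Type*} (v : V → ℕ → ℕ) {S : Finset ℕ}
    (hS : ∀ p ∈ S, p.Prime) (n : ℕ → ℕ) {B : Finset V} {M : ℝ} (hM0 : 0 ≤ M)
    (hinj : ∀ a ∈ B, ∀ b ∈ B, (∀ p ∈ S, v a p = v b p) → a = b)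
    (hn : ∀ a ∈ B, ∀ p ∈ S, n p ≤ v a p)
    (hM : ∀ a ∈ B, ∏ p ∈ S, (p : ℝ) ^ (v a p - n p) ≤ M) :
    (B.card : ℝ) ≤ M := by
  let u : V → ℕ := fun a => ∏ p ∈ S, p ^ (v a p - n p)
  have hfac : ∀ a, ∀ p ∈ S, (u a).factorization p = v a p - n p := by
    intro a p hp
    simp only [u]
    rw [Nat.factorization_prod fun q hq => pow_ne_zero _ (hS q hq).ne_zero, Finset.sum_apply',
      sum_eq_single p]
    · simp [(hS p hp).factorization_pow]
    · intro q hq hqp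
      simp [(hS q hq).factorization_pow, hqp]
    · exact fun h => absurd hp h
  have hcard : B.card ≤ (Icc 1 ⌊M⌋₊).card := by
    refine card_le_card_of_injOn u (fun a ha => ?_) (fun a ha b hb hab => ?_)
    · rw [mem_coe, mem_Icc]
      refine ⟨Nat.one_le_iff_ne_zero.2 (prod_ne_zero_iff.2 fun p hp =>
        pow_ne_zero _ (hS p hp).ne_zero), Nat.le_floor ?_⟩
      simpa [u] using hM a ha
    · refine hinj a ha b hb fun p hp => ?_
      have h1 := hfac a p hp
      have h2 := hfac b p hp
      have h3 := hn a ha p hp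
      have h4 := hn b hb p hp
      rw [hab] at h1
      omega
  rw [Nat.card_Icc, Nat.add_sub_cancel] at hcard
  exact (Nat.cast_le.2 hcard).trans (Nat.floor_le hM0)

variable {ι V : Type*} [Fintype ι] [Nonempty ι] [DecidableEq ι]

/-- `IsGcdGraph v S A E M` says that the vertices in each `A i` are determined by their valuations
at the primes of `S`, and that `E` is a set of tuples along which the part of `e i` supported on `S`,
divided by the gcd of the tuple, is at most `M i`. -/
structure IsGcdGraph (v : V → ℕ → ℕ) (S : Finset ℕ) (A : ι → Finset V) (E : Finset (ι → V))
    (M : ι → ℝ) : Prop where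
  eq_of_val : ∀ i, ∀ a ∈ A i, ∀ b ∈ A i, (∀ p ∈ S, v a p = v b p) → a = b
  mem : ∀ e ∈ E, ∀ i, e i ∈ A i
  nonneg : ∀ i, 0 ≤ M i
  prod_le : ∀ e ∈ E, ∀ i,
    ∏ p ∈ S, (p : ℝ) ^ (v (e i) p - minVal fun l => v (e l) p) ≤ M i

/-- The bound `|E| ≤ (K ∏ M)^(1-θ) (∏ |A|)^θ` for all gcd graphs on the set of primes `S`. -/
def GcdGraphBound (ι : Type*) {V : Type*} [Fintype ι] [Nonempty ι] (v : V → ℕ → ℕ) (θ : ℝ)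
    (S : Finset ℕ) (K : ℝ) : Prop :=
  ∀ (A : ι → Finset V) (E : Finset (ι → V)) (M : ι → ℝ), IsGcdGraph v S A E M →
    (E.card : ℝ) ≤ (K * ∏ i, M i) ^ (1 - θ) * (∏ i, ((A i).card : ℝ)) ^ θ

/-- The proportion of elements of `A` whose valuation at `p` equals `m`. -/
noncomputable def valDensity (v : V → ℕ → ℕ) (p : ℕ) (A : Finset V) (m : ℕ) : ℝ :=
  ((A.filter fun a => v a p = m).card : ℝ) / A.card

lemma valDensity_nonneg (v : V → ℕ → ℕ) (p : ℕ) (A : Finset V) (m : ℕ) :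
    0 ≤ valDensity v p A m := by
  unfold valDensity; positivity

lemma sum_valDensity_le_one (v : V → ℕ → ℕ) (p : ℕ) (A : Finset V) (T : Finset ℕ) :
    ∑ m ∈ T, valDensity v p A m ≤ 1 := by
  unfold valDensity
  rw [← sum_div]
  refine div_le_one_of_le₀ ?_ (by positivity)
  rw [← Nat.cast_sum, sum_card_fiberwise_eq_card_filter]
  exact_mod_cast card_filter_le _ _

variable {v : V → ℕ → ℕ} {θ K : ℝ} {S : Finset ℕ} {A : ι → Finset V} {E : Finset (ι → V)}
  {M : ι → ℝ} {p : ℕ}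

omit [DecidableEq ι] in
lemma IsGcdGraph.block (h : IsGcdGraph v S A E M) (hp : p ∈ S) (hp0 : 0 < p) (j : ι → ℕ) :
    IsGcdGraph v (S.erase p) (fun i => (A i).filter fun a => v a p = j i)
      (E.filter fun e => (fun i => v (e i) p) = j)
      (fun i => M i * ((p : ℝ)⁻¹) ^ (j i - minVal j)) where
  eq_of_val i a ha b hb hab := by
    rw [mem_filter] at ha hb
    refine h.eq_of_val i a ha.1 b hb.1 fun q hq => ?_
    by_cases hqp : q = p
    · rw [hqp, ha.2, hb.2]
    · exact hab q (mem_erase.2 ⟨hqp, hq⟩)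
  mem e he i := by
    obtain ⟨heE, rfl⟩ := mem_filter.1 he
    exact mem_filter.2 ⟨h.mem e heE i, rfl⟩
  nonneg i := mul_nonneg (h.nonneg i) (by positivity)
  prod_le e he i := by
    obtain ⟨heE, rfl⟩ := mem_filter.1 he
    have := h.prod_le e heE i
    rw [← mul_prod_erase S _ hp] at this
    rw [inv_pow, ← div_eq_mul_inv, le_div_iff₀ (by positivity), mul_comm]
    exact this

omit [DecidableEq ι] in
lemma card_block_le (hK : 0 ≤ K) (hIH : GcdGraphBound ι v θ (S.erase p) K)
    (h : IsGcdGraph v S A E M) (hp : p ∈ S) (hp0 : 0 < p) (j : ι → ℕ) :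
    ((E.filter fun e => (fun i => v (e i) p) = j).card : ℝ) ≤
      (K * ∏ i, M i) ^ (1 - θ) * (∏ i, ((A i).card : ℝ)) ^ θ *
        ∏ i, (valDensity v p (A i) (j i) ^ θ * (((p : ℝ)⁻¹) ^ (1 - θ)) ^ (j i - minVal j)) := by
  have hM : 0 ≤ ∏ i, M i := prod_nonneg fun i _ => h.nonneg i
  rcases E.eq_empty_or_nonempty with rfl | ⟨e, he⟩
  · simp only [filter_empty, card_empty, Nat.cast_zero]
    have := fun i => valDensity_nonneg v p (A i) (j i)
    exact mul_nonneg (by positivity) (prod_nonneg fun i _ =>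
      mul_nonneg (Real.rpow_nonneg (this i) _) (by positivity))
  have hA : ∀ i, ((A i).card : ℝ) ≠ 0 := fun i => by
    exact_mod_cast (card_pos.2 ⟨e i, h.mem e he i⟩).ne'
  refine (hIH _ _ _ (h.block hp hp0 j)).trans (le_of_eq ?_)
  have h1 : ∀ i, (((A i).filter fun a => v a p = j i).card : ℝ) =
      (A i).card * valDensity v p (A i) (j i) := fun i => by
    unfold valDensity
    rw [mul_div_cancel₀ _ (hA i)]
  simp_rw [h1]
  rw [prod_mul_distrib, prod_mul_distrib, prod_mul_distrib, ← mul_assoc K,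
    Real.mul_rpow (by positivity) (by positivity),
    Real.mul_rpow (by positivity) (prod_nonneg fun i _ => valDensity_nonneg _ _ _ _),
    Real.finsetProd_rpow _ _ (fun i _ => valDensity_nonneg _ _ _ _),
    ← Real.finsetProd_rpow _ _ (fun i _ => by positivity)]
  have h2 : ∀ i, (((p : ℝ)⁻¹) ^ (j i - minVal j)) ^ (1 - θ) =
      (((p : ℝ)⁻¹) ^ (1 - θ)) ^ (j i - minVal j) := fun i =>
    (Real.rpow_pow_comm (by positivity) _ _).symm
  simp_rw [h2]
  ring

omit [Nonempty ι] in
lemma exists_val_mem_piFinset_range (v : V → ℕ → ℕ) (E : Finset (ι → V)) (p : ℕ) :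
    ∃ L, ∀ e ∈ E, (fun i => v (e i) p) ∈ Fintype.piFinset fun _ : ι => range L := by
  refine ⟨(E.sup fun e => univ.sup fun i => v (e i) p) + 1, fun e he => ?_⟩
  simp only [Fintype.mem_piFinset, mem_range, Nat.lt_succ_iff]
  intro i
  exact (le_sup (f := fun i => v (e i) p) (mem_univ i)).trans
    (le_sup (f := fun e : ι → V => univ.sup fun i => v (e i) p) he)

lemma GcdGraphBound.of_erase (hθ : 1 ≤ Fintype.card ι * θ) (hθ2 : θ ≤ 1 / 2) (hK : 0 ≤ K)
    (hp : p ∈ S) (hpp : p.Prime) (hIH : GcdGraphBound ι v θ (S.erase p) K) :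
    GcdGraphBound ι v θ S (2 ^ (4 * Fintype.card ι) * K) := by
  intro A E M h
  obtain ⟨L, hL⟩ := exists_val_mem_piFinset_range v E p
  set q := ((p : ℝ)⁻¹) ^ (1 - θ) with hq
  have hM : 0 ≤ ∏ i, M i := prod_nonneg fun i _ => h.nonneg i
  have hp2 : (p : ℝ)⁻¹ ≤ 1 / 2 := by
    rw [one_div]
    exact inv_anti₀ (by norm_num) (by exact_mod_cast hpp.two_le)
  have hq0 : 0 ≤ q := by positivity
  have hq34 : q ≤ 3 / 4 := by
    calc q ≤ (1 / 2 : ℝ) ^ (1 - θ) := Real.rpow_le_rpow (by positivity) hp2 (by linarith)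
      _ ≤ (1 / 2 : ℝ) ^ (1 / 2 : ℝ) :=
          Real.rpow_le_rpow_of_exponent_ge (by norm_num) (by norm_num) (by linarith)
      _ ≤ 3 / 4 := by
          rw [← Real.sqrt_eq_rpow, Real.sqrt_le_left (by norm_num)]
          norm_num
  have hG : (1 - q)⁻¹ ≤ (16 : ℝ) ^ (1 - θ) := by
    calc (1 - q)⁻¹ ≤ 4 := by
          rw [inv_le_comm₀ (by linarith) (by norm_num)]
          linarith
      _ = (16 : ℝ) ^ (1 / 2 : ℝ) := by
          rw [← Real.sqrt_eq_rpow, show (16 : ℝ) = 4 ^ 2 by norm_num,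
            Real.sqrt_sq (by norm_num)]
      _ ≤ _ := Real.rpow_le_rpow_of_exponent_le (by norm_num) (by linarith)
  have hsum := sum_le_of_le_prod_shift (θ := θ) hθ (β := fun i => valDensity v p (A i)) (y := 1)
    (B := 1) (g := fun d => q ^ d) (L := L) (fun i m => valDensity_nonneg _ _ _ _)
    (sub_prob_le_one fun i => sum_valDensity_le_one v p (A i))
    (fun i => sum_valDensity_le_one v p (A i)) (fun d => by positivity)
    ((sum_range_pow_le hq0 (by linarith) L).trans hG) Subset.rfl (fun j _ => le_rfl)
  rw [Real.one_rpow, mul_one, mul_one] at hsum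
  rw [card_eq_sum_card_fiberwise hL, Nat.cast_sum]
  calc _ ≤ ∑ j ∈ Fintype.piFinset fun _ : ι => range L,
        (K * ∏ i, M i) ^ (1 - θ) * (∏ i, ((A i).card : ℝ)) ^ θ *
        ∏ i, (valDensity v p (A i) (j i) ^ θ * q ^ (j i - minVal j)) :=
        sum_le_sum fun j _ => card_block_le hK hIH h hp hpp.pos j
    _ ≤ (K * ∏ i, M i) ^ (1 - θ) * (∏ i, ((A i).card : ℝ)) ^ θ *
          ((16 : ℝ) ^ (1 - θ)) ^ Fintype.card ι := by
        rw [← mul_sum]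
        exact mul_le_mul_of_nonneg_left hsum (mul_nonneg (Real.rpow_nonneg (mul_nonneg hK hM) _)
          (Real.rpow_nonneg (prod_nonneg fun i _ => Nat.cast_nonneg _) _))
    _ = _ := by
        have h16 : ((2 : ℝ) ^ (4 * Fintype.card ι)) ^ (1 - θ) =
            ((16 : ℝ) ^ (1 - θ)) ^ Fintype.card ι := by
          rw [Real.rpow_pow_comm (x := 16) (by norm_num) (1 - θ), pow_mul]
          norm_num only
        rw [mul_assoc (2 ^ _) K, Real.mul_rpow (pow_nonneg zero_le_two _) (mul_nonneg hK hM), h16,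
          mul_right_comm, mul_comm ((K * _) ^ _)]

lemma GcdGraphBound.of_forall_erase {c : ℝ} (hS : ∀ p ∈ S, p.Prime) (hθ0 : 0 ≤ θ) (hθ1 : θ ≤ 1)
    (hc : ∀ p ∈ S, ∀ (α : ι → ℕ → ℝ) (L : ℕ) (w : (ι → ℕ) → ℝ),
      (∀ i m, 0 ≤ α i m) → (∀ i, ∀ T : Finset ℕ, ∑ m ∈ T, α i m ≤ 1) →
      1 ≤ ∑ j ∈ Fintype.piFinset fun _ : ι => range L, w j →
      (∀ j ∈ Fintype.piFinset fun _ : ι => range L,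
        w j ≤ ∏ i, (α i (j i) ^ θ * (((p : ℝ)⁻¹) ^ (1 - θ)) ^ (j i - minVal j))) →
      ∃ n, ∑ j ∈ (Fintype.piFinset fun _ : ι => range L).filter (fun j => minVal j ≠ n), w j ≤
        c * ((p : ℝ)⁻¹) ^ (Fintype.card ι * θ))
    (hsum : ∑ p ∈ S, c * ((p : ℝ)⁻¹) ^ (Fintype.card ι * θ) ≤ 1 / 2)
    (hIH : ∀ p ∈ S, GcdGraphBound ι v θ (S.erase p) 2) :
    GcdGraphBound ι v θ S 2 := by
  classical
  intro A E M h
  by_contra! hcon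
  have hM : 0 ≤ ∏ i, M i := prod_nonneg fun i _ => h.nonneg i
  have hE : (0 : ℝ) < E.card := lt_of_le_of_lt (by positivity) hcon
  have hbad : ∀ p ∈ S, ∃ n, ((E.filter fun e => minVal (fun i => v (e i) p) ≠ n).card : ℝ) ≤
      c * ((p : ℝ)⁻¹) ^ (Fintype.card ι * θ) * E.card := by
    intro p hp
    obtain ⟨L, hL⟩ := exists_val_mem_piFinset_range v E p
    let w : (ι → ℕ) → ℝ := fun j =>
      ((E.filter fun e => (fun i => v (e i) p) = j).card : ℝ) / E.card
    obtain ⟨n, hn⟩ := hc p hp (fun i => valDensity v p (A i)) L w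
      (fun i m => valDensity_nonneg _ _ _ _) (fun i => sum_valDensity_le_one v p (A i))
      (by
        simp only [w]
        rw [← sum_div, ← Nat.cast_sum, ← card_eq_sum_card_fiberwise hL, div_self hE.ne'])
      (by
        intro j _
        simp only [w]
        rw [div_le_iff₀ hE, mul_comm _ (E.card : ℝ)]
        refine (card_block_le (by norm_num) (hIH p hp) h hp (hS p hp).pos j).trans ?_
        refine mul_le_mul_of_nonneg_right hcon.le (prod_nonneg fun i _ => ?_)
        exact mul_nonneg (Real.rpow_nonneg (valDensity_nonneg _ _ _ _) _) (by positivity))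
    refine ⟨n, ?_⟩
    rw [← div_le_iff₀ hE]
    refine le_trans (le_of_eq ?_) hn
    simp only [w]
    rw [← sum_div, ← Nat.cast_sum]
    congr 2
    rw [card_eq_sum_card_fiberwise (f := fun e i => v (e i) p)
      (t := (Fintype.piFinset fun _ : ι => range L).filter (fun j => minVal j ≠ n))]
    · refine sum_congr rfl fun j hj => ?_
      rw [filter_filter]
      congr 1
      refine filter_congr fun e _ => ⟨fun h => h.2, fun h => ⟨?_, h⟩⟩
      rw [h]
      exact (mem_filter.1 hj).2
    · intro e he
      have he := mem_filter.1 he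
      exact mem_filter.2 ⟨hL e he.1, he.2⟩
  choose! n hn using hbad
  set good := E.filter fun e => ∀ p ∈ S, minVal (fun i => v (e i) p) = n p with hgood
  have hcover : E ⊆ good ∪ S.biUnion fun p =>
      E.filter fun e => minVal (fun i => v (e i) p) ≠ n p := by
    intro e he
    by_cases hg : ∀ p ∈ S, minVal (fun i => v (e i) p) = n p
    · exact mem_union_left _ (mem_filter.2 ⟨he, hg⟩)
    · push Not at hg
      obtain ⟨p, hp, hpn⟩ := hg
      exact mem_union_right _ (mem_biUnion.2 ⟨p, hp, mem_filter.2 ⟨he, hpn⟩⟩)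
  have hhalf : (E.card : ℝ) ≤ 2 * good.card := by
    have h1 : (E.card : ℝ) ≤ good.card +
        ∑ p ∈ S, ((E.filter fun e => minVal (fun i => v (e i) p) ≠ n p).card : ℝ) := by
      exact_mod_cast (card_le_card hcover).trans ((card_union_le _ _).trans
        (Nat.add_le_add_left card_biUnion_le _))
    have h2 := sum_le_sum hn
    rw [← sum_mul] at h2
    have h3 := mul_le_mul_of_nonneg_right hsum hE.le
    linarith
  let B : ι → Finset V := fun i => (A i).filter fun a =>
    (∀ p ∈ S, n p ≤ v a p) ∧ ∏ p ∈ S, (p : ℝ) ^ (v a p - n p) ≤ M i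
  have hB : ∀ i, ((B i).card : ℝ) ≤ M i := fun i =>
    card_le_of_prod_pow_le v hS n (h.nonneg i)
      (fun a ha b hb => h.eq_of_val i a (mem_filter.1 ha).1 b (mem_filter.1 hb).1)
      (fun a ha => (mem_filter.1 ha).2.1) (fun a ha => (mem_filter.1 ha).2.2)
  have hgoodB : good ⊆ Fintype.piFinset B := by
    intro e he
    obtain ⟨he, hmin⟩ := mem_filter.1 he
    refine Fintype.mem_piFinset.2 fun i => mem_filter.2 ⟨h.mem e he i, fun p hp => ?_, ?_⟩
    · rw [← hmin p hp]
      exact minVal_le (fun l => v (e l) p) i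
    · refine le_trans (le_of_eq ?_) (h.prod_le e he i)
      exact prod_congr rfl fun p hp => by rw [hmin p hp]
  have hE1 : (E.card : ℝ) ≤ 2 * ∏ i, M i := by
    refine hhalf.trans (mul_le_mul_of_nonneg_left ?_ (by norm_num))
    have h1 : (good.card : ℝ) ≤ ∏ i, ((B i).card : ℝ) := by
      have := card_le_card hgoodB
      rw [Fintype.card_piFinset] at this
      exact_mod_cast this
    exact h1.trans (prod_le_prod (fun i _ => by positivity) fun i _ => hB i)
  have hE2 : (E.card : ℝ) ≤ ∏ i, ((A i).card : ℝ) := by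
    have := card_le_card (fun e he => Fintype.mem_piFinset.2 (h.mem e he) :
      E ⊆ Fintype.piFinset A)
    rw [Fintype.card_piFinset] at this
    exact_mod_cast this
  refine absurd hcon (not_lt.2 ?_)
  calc (E.card : ℝ) = (E.card : ℝ) ^ (1 - θ) * (E.card : ℝ) ^ θ := by
        rw [← Real.rpow_add hE]; simp
    _ ≤ _ := by
        gcongr

/-- There is a threshold such that gcd graphs satisfy the bound with a loss of `2 ^ (4 * k)` for each
prime up to the threshold and no loss for the larger primes. -/
theorem exists_gcdGraphBound (v : V → ℕ → ℕ) (hθ : 1 < Fintype.card ι * θ) (hθ0 : 0 < θ)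
    (hθ2 : θ ≤ 1 / 2) :
    ∃ p₀ : ℕ, ∀ S : Finset ℕ, (∀ p ∈ S, p.Prime) →
      GcdGraphBound ι v θ S
        ((2 ^ (4 * Fintype.card ι)) ^ (S.filter fun p => p ≤ p₀).card * 2) := by
  obtain ⟨c, hc⟩ := eventually_exists_sum_minVal_ne_le (ι := ι) hθ hθ0 hθ2
  have hlim : Tendsto (fun n : ℕ => (n : ℝ)⁻¹) atTop (𝓝[>] 0) :=
    tendsto_inv_atTop_nhdsGT_zero.comp tendsto_natCast_atTop_atTop
  obtain ⟨p₁, hp₁⟩ := eventually_atTop.1 (hlim.eventually hc)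
  have hsummable : Summable fun n : ℕ => c * ((n : ℝ)⁻¹) ^ (Fintype.card ι * θ) := by
    refine Summable.mul_left _ ?_
    simp_rw [fun n : ℕ => Real.inv_rpow (Nat.cast_nonneg (α := ℝ) n) (Fintype.card ι * θ)]
    exact Real.summable_nat_rpow_inv.2 hθ
  obtain ⟨T, hT⟩ := summable_iff_vanishing_norm.1 hsummable (1 / 2) (by norm_num)
  refine ⟨max p₁ (T.sup id), fun S => ?_⟩
  induction S using Finset.strongInduction with
  | H S ih =>
    intro hS
    set p₀ := max p₁ (T.sup id) with hp₀
    by_cases hsmall : ∃ p ∈ S, p ≤ p₀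
    · obtain ⟨p, hp, hpp₀⟩ := hsmall
      have hmem : p ∈ S.filter fun p => p ≤ p₀ := mem_filter.2 ⟨hp, hpp₀⟩
      have := GcdGraphBound.of_erase hθ.le hθ2 (by positivity) hp (hS p hp)
        (ih _ (erase_ssubset hp) fun q hq => hS q (mem_of_mem_erase hq))
      rwa [filter_erase, ← mul_assoc, ← pow_succ', card_erase_add_one hmem] at this
    · push Not at hsmall
      have hcard : ∀ S' ⊆ S, (S'.filter fun p => p ≤ p₀).card = 0 := fun S' hS' =>
        card_eq_zero.2 (filter_eq_empty_iff.2 fun p hp => not_le.2 (hsmall p (hS' hp)))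
      rw [hcard S Subset.rfl, pow_zero, one_mul]
      refine GcdGraphBound.of_forall_erase hS hθ0.le (by linarith)
        (fun p hp => hp₁ p ((le_max_left _ _).trans (hsmall p hp).le)) ?_ fun p hp => ?_
      · refine (le_abs_self _).trans (hT S (disjoint_left.2 fun p hp hpT => ?_)).le
        exact absurd (hsmall p hp) (not_lt.2 ((le_sup (f := id) hpT).trans (le_max_right _ _)))
      · have := ih _ (erase_ssubset hp) fun q hq => hS q (mem_of_mem_erase hq)
        rwa [hcard _ (erase_subset _ _), pow_zero, one_mul] at this

end Valuations

lemma prod_pow_sub_le_div {ι : Type*} [Fintype ι] [Nonempty ι] {S : Finset ℕ}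
    (hS : ∀ p ∈ S, p.Prime) {a : ι → ℕ} (ha : ∀ i, a i ≠ 0) {g : ℕ} (hg : ∀ i, g ∣ a i) (i : ι)
    (hi : (a i).primeFactors ⊆ S) :
    ∏ p ∈ S, p ^ ((a i).factorization p - minVal fun l => (a l).factorization p) ≤ a i / g := by
  have hag : a i / g ≠ 0 := by
    have := Nat.div_mul_cancel (hg i)
    intro h
    rw [h, zero_mul] at this
    exact ha i this.symm
  calc _ ≤ ∏ p ∈ S, p ^ (a i / g).factorization p := by
        refine prod_le_prod' fun p hp => Nat.pow_le_pow_right (hS p hp).pos ?_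
        rw [Nat.factorization_div (hg i), Finsupp.tsub_apply]
        refine Nat.sub_le_sub_left ?_ _
        obtain ⟨l, hl⟩ := exists_eq_minVal fun l => (a l).factorization p
        rw [← hl]
        have hg0 : g ≠ 0 := fun h => ha l (by simpa [h] using hg l)
        exact (Nat.factorization_le_iff_dvd hg0 (ha l)).2 (hg l) p
    _ = ∏ p ∈ (a i / g).primeFactors, p ^ (a i / g).factorization p := by
        symm
        refine prod_subset ((Nat.primeFactors_mono (Nat.div_dvd_of_dvd (hg i)) (ha i)).trans hi)
          fun p _ hp => ?_
        rw [← Nat.support_factorization, Finsupp.notMem_support_iff] at hp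
        rw [hp, pow_zero]
    _ = a i / g := Nat.prod_factorization_pow_eq_self hag

lemma le_rpow_neg_mul_of_mul_le {δ n Q κ θ : ℝ} (hδ : 0 < δ) (hn : 0 < n) (hQ : 0 ≤ Q)
    (hκ : 0 < κ) (hθ : 1 - θ = κ⁻¹) (h : δ * n ≤ Q ^ (1 - θ) * n ^ θ) :
    n ≤ δ ^ (-κ) * Q := by
  have hnθ : 0 < n ^ θ := Real.rpow_pos_of_pos hn _
  have h1 : n = n ^ (1 - θ) * n ^ θ := by
    rw [← Real.rpow_add hn]; simp
  have h2 : δ * n ^ (1 - θ) ≤ Q ^ (1 - θ) := by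
    refine le_of_mul_le_mul_right ?_ hnθ
    rwa [mul_assoc, ← h1]
  have h3 := Real.rpow_le_rpow (by positivity) h2 hκ.le
  rw [hθ, Real.mul_rpow hδ.le (by positivity), Real.rpow_inv_rpow hn.le hκ.ne',
    Real.rpow_inv_rpow hQ hκ.ne'] at h3
  rw [Real.rpow_neg hδ.le, inv_mul_eq_div, le_div_iff₀ (by positivity), mul_comm]
  exact h3

theorem gcd_problem_high_dim_explicit (k : ℕ) (hk : 3 ≤ k) (ε : ℝ)
    (hε : ε ∈ Set.Ioo (0:ℝ) 1) :
    ∃ p₀ : ℕ,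
      ∀ (X : Fin k → ℝ) (D δ : ℝ) (A : Fin k → Finset ℤ),
        (∀ i, 1 ≤ X i) → 1 ≤ D → (∀ i, D ≤ X i) → δ ∈ Set.Ioc (0:ℝ) 1 →
        (∀ i, ∀ a ∈ A i, X i ≤ (a : ℝ) ∧ (a : ℝ) ≤ 2 * X i) →
        δ * ∏ i, ((A i).card : ℝ) ≤
          (((Fintype.piFinset A).filter
            (fun a => D ≤ ((Finset.univ.gcd a : ℤ) : ℝ))).card : ℝ) →
        ∏ i, ((A i).card : ℝ) ≤
          ((2 : ℝ) ^ (4 * k)) ^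
              (1 + ((Finset.range (p₀ + 1)).filter
                (fun p : ℕ => p.Prime ∧ ∃ i, ∃ a ∈ A i, (p : ℤ) ∣ a)).card) *
            δ ^ (-((k : ℝ) + ε / ((k : ℝ) - 1)) / ((k : ℝ) - 1)) *
            (∏ i, X i) / D ^ k := by
  obtain ⟨hε0, hε1⟩ := hε
  have hk3 : (3 : ℝ) ≤ k := by exact_mod_cast hk
  have : Nonempty (Fin k) := ⟨⟨0, by omega⟩⟩
  set κ : ℝ := ((k : ℝ) + ε / ((k : ℝ) - 1)) / ((k : ℝ) - 1) with hκ
  have hε' : 0 < ε / ((k : ℝ) - 1) := div_pos hε0 (by linarith)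
  have hε2 : ε / ((k : ℝ) - 1) * (k - 1) = ε := div_mul_cancel₀ _ (by linarith)
  have hε3 : ε / ((k : ℝ) - 1) ≤ 1 / 2 := by
    rw [div_le_div_iff₀ (by linarith) (by norm_num)]
    linarith
  have hκ0 : 0 < κ := div_pos (by linarith) (by linarith)
  set θ : ℝ := 1 - κ⁻¹ with hθ
  have hθ' : θ = (1 + ε / ((k : ℝ) - 1)) / (k + ε / ((k : ℝ) - 1)) := by
    rw [hθ, hκ, inv_div, eq_div_iff (by linarith), sub_mul, div_mul_cancel₀ _ (by linarith)]
    ring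
  have hθ0 : 0 < θ := by
    rw [hθ']
    exact div_pos (by linarith) (by linarith)
  have hθ2 : θ ≤ 1 / 2 := by
    rw [hθ', div_le_div_iff₀ (by linarith) (by norm_num)]
    linarith
  have hθ1 : 1 < Fintype.card (Fin k) * θ := by
    rw [Fintype.card_fin, hθ', ← mul_div_assoc, one_lt_div (by linarith)]
    nlinarith
  obtain ⟨p₀, hp₀⟩ := exists_gcdGraphBound (ι := Fin k)
    (fun (a : ℤ) p => a.natAbs.factorization p) hθ1 hθ0 hθ2
  refine ⟨p₀, fun X D δ A hX hD _ hδ hA hcount => ?_⟩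
  have hXpos : ∀ i, 0 < X i := fun i => one_pos.trans_le (hX i)
  have hDpos : 0 < D := one_pos.trans_le hD
  have hδ0 : 0 < δ := hδ.1
  have hAX : 0 < ∏ i, X i := prod_pos fun i _ => hXpos i
  have hn0 : 0 ≤ ∏ i, ((A i).card : ℝ) := prod_nonneg fun i _ => Nat.cast_nonneg _
  rcases hn0.eq_or_lt with hn | hn
  · rw [← hn]
    positivity
  have hApos : ∀ i, ∀ a ∈ A i, 0 < a := fun i a ha => by
    have := (hXpos i).trans_le (hA i a ha).1
    exact_mod_cast this
  let S : Finset ℕ := univ.biUnion fun i => (A i).biUnion fun a => a.natAbs.primeFactors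
  have hSmem : ∀ i, ∀ a ∈ A i, a.natAbs.primeFactors ⊆ S := fun i a ha p hp =>
    mem_biUnion.2 ⟨i, mem_univ _, mem_biUnion.2 ⟨a, ha, hp⟩⟩
  have hS : ∀ p ∈ S, p.Prime ∧ ∃ i, ∃ a ∈ A i, (p : ℤ) ∣ a := by
    intro p hp
    obtain ⟨i, -, hp⟩ := mem_biUnion.1 hp
    obtain ⟨a, ha, hp⟩ := mem_biUnion.1 hp
    exact ⟨Nat.prime_of_mem_primeFactors hp, i, a, ha,
      Int.natCast_dvd.2 (Nat.dvd_of_mem_primeFactors hp)⟩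
  have hgraph : IsGcdGraph (fun (a : ℤ) p => a.natAbs.factorization p) S A
      ((Fintype.piFinset A).filter (fun a => D ≤ ((Finset.univ.gcd a : ℤ) : ℝ)))
      (fun i => 2 * X i / D) := by
    refine ⟨fun i a ha b hb hab => ?_, fun e he i =>
      Fintype.mem_piFinset.1 (mem_filter.1 he).1 i, fun i => ?_, fun e he i => ?_⟩
    · have ha0 := hApos i a ha
      have hb0 := hApos i b hb
      have : a.natAbs = b.natAbs := by
        refine Nat.eq_of_factorization_eq (by omega) (by omega) fun p => ?_
        by_cases hp : p ∈ S
        · exact hab p hp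
        · rw [Finsupp.notMem_support_iff.1 fun h => hp (hSmem i a ha h),
            Finsupp.notMem_support_iff.1 fun h => hp (hSmem i b hb h)]
      omega
    · have := hXpos i
      positivity
    · obtain ⟨heA, hgD⟩ := mem_filter.1 he
      rw [Fintype.mem_piFinset] at heA
      set g : ℤ := univ.gcd e with hg
      have hg0 : 0 < g := by
        have := hDpos.trans_le hgD
        exact_mod_cast this
      have hdvd : ∀ l, g.natAbs ∣ (e l).natAbs := fun l =>
        Int.natAbs_dvd_natAbs.2 (gcd_dvd (mem_univ l))
      have h1 := prod_pow_sub_le_div (fun p hp => (hS p hp).1) (a := fun l => (e l).natAbs)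
        (fun l => by have := hApos l _ (heA l); omega) hdvd i (hSmem i _ (heA i))
      have h2 : (∏ p ∈ S, (p : ℝ) ^ ((e i).natAbs.factorization p -
          minVal fun l => (e l).natAbs.factorization p)) ≤
          (((e i).natAbs / g.natAbs : ℕ) : ℝ) := by
        exact_mod_cast h1
      refine h2.trans (Nat.cast_div_le.trans ?_)
      rw [Nat.cast_natAbs, Nat.cast_natAbs, abs_of_pos hg0, abs_of_pos (hApos i _ (heA i))]
      have := hXpos i
      exact div_le_div₀ (by positivity) (hA i _ (heA i)).2 hDpos hgD
  have hbound := hcount.trans (hp₀ S (fun p hp => (hS p hp).1) A _ _ hgraph)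
  have hprod : ∏ i, (2 * X i / D) = 2 ^ k * (∏ i, X i) / D ^ k := by
    rw [prod_div_distrib, prod_mul_distrib]
    simp
  rw [hprod, Fintype.card_fin] at hbound
  have hfinal := le_rpow_neg_mul_of_mul_le hδ0 hn (by positivity) hκ0 (by rw [hθ]; ring) hbound
  refine hfinal.trans ?_
  have hcard : (S.filter fun p => p ≤ p₀).card ≤ ((Finset.range (p₀ + 1)).filter
      (fun p : ℕ => p.Prime ∧ ∃ i, ∃ a ∈ A i, (p : ℤ) ∣ a)).card := by
    refine card_le_card fun p hp => ?_
    obtain ⟨hpS, hp⟩ := mem_filter.1 hp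
    exact mem_filter.2 ⟨mem_range.2 (by omega), hS p hpS⟩
  have hpow : ((2 : ℝ) ^ (4 * k)) ^ (S.filter fun p => p ≤ p₀).card * 2 * 2 ^ k ≤
      ((2 : ℝ) ^ (4 * k)) ^ (1 + ((Finset.range (p₀ + 1)).filter
        (fun p : ℕ => p.Prime ∧ ∃ i, ∃ a ∈ A i, (p : ℤ) ∣ a)).card) := by
    rw [pow_add, pow_one, mul_assoc, ← pow_succ', mul_comm]
    have h1 : (1 : ℝ) ≤ 2 ^ (4 * k) := one_le_pow₀ (by norm_num)
    refine mul_le_mul (pow_le_pow_right₀ (by norm_num) (by omega))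
      (pow_le_pow_right₀ h1 hcard) (by positivity) (by positivity)
  rw [neg_div, ← hκ]
  calc _ = (((2 : ℝ) ^ (4 * k)) ^ (S.filter fun p => p ≤ p₀).card * 2 * 2 ^ k) *
        (δ ^ (-κ) * (∏ i, X i) / D ^ k) := by ring
    _ ≤ _ := mul_le_mul_of_nonneg_right hpow (by positivity)
    _ = _ := by ring
end

section
/- Let k ≥ 2 be an integer, let X_1, …, X_k, D ∈ [1, ∞) be real numbers with D ≤ min(X_1, …, X_k), and let δ ∈ (0,1]. Let A_1, …, A_k be finite sets of integers with A_i ⊆ [X_i, 2X_i] for each i, and suppose that the number of tuples (a_1, …, a_k) ∈ A_1 × ⋯ × A_k with gcd(a_1, …, a_k) ≥ D is at least δ·∏_{i=1}^k |A_i|. Then for every ε ∈ (0,1) there is a constant C(k,ε) > 0, depending only on k and ε, such that ∏_{i=1}^k |A_i| ≤ C(k,ε) · δ^{-k/(k-1)} · (∏_{i=1}^k X_i) / D^{k-ε}. -/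
open Finset

/-- The divisor bound `τ(n) ≪_s n ^ s`. -/
theorem exists_card_divisors_le_rpow {s : ℝ} (hs : 0 < s) :
    ∃ C : ℝ, 0 < C ∧ ∀ n : ℕ, n ≠ 0 → (#n.divisors : ℝ) ≤ C * (n : ℝ) ^ s := by
  have hl : 0 < Real.log 2 := Real.log_pos one_lt_two
  set t := s * Real.log 2 with ht_def
  have ht : 0 < t := mul_pos hs hl
  set K : ℝ := 1 + 1 / t with hK_def
  have hK : 1 ≤ K := by rw [hK_def]; linarith [one_div_pos.2 ht]
  set N : ℕ := ⌈(2 : ℝ) ^ (1 / s)⌉₊ with hN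
  have local_bound : ∀ p f : ℕ, p.Prime →
      ((f + 1 : ℕ) : ℝ) ≤ (if p < N then K else 1) * ((p : ℝ) ^ f) ^ s := by
    intro p f hp
    have hp2 : (2 : ℝ) ≤ p := by exact_mod_cast hp.two_le
    have hswap : ((p : ℝ) ^ f) ^ s = ((p : ℝ) ^ s) ^ f := by
      rw [← Real.rpow_natCast, ← Real.rpow_natCast, ← Real.rpow_mul (by positivity),
        ← Real.rpow_mul (by positivity), mul_comm]
    rw [hswap]
    split_ifs with h
    · have h1 : 1 + f * t ≤ ((2 : ℝ) ^ s) ^ f := by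
        have : ((2 : ℝ) ^ s) ^ f = Real.exp (f * t) := by
          rw [Real.rpow_def_of_pos two_pos, ← Real.exp_nat_mul, ht_def, mul_comm s]
        rw [this]
        linarith [Real.add_one_le_exp (f * t)]
      have h2 : ((2 : ℝ) ^ s) ^ f ≤ ((p : ℝ) ^ s) ^ f := by gcongr
      calc ((f + 1 : ℕ) : ℝ) ≤ K * (1 + f * t) := by
            have : K * (1 + f * t) = 1 + f + 1 / t + f * t := by
              rw [hK_def]; field_simp; ring
            rw [this]; push_cast
            have : 0 < 1 / t := by positivity
            have : 0 ≤ f * t := by positivity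
            linarith
        _ ≤ K * ((p : ℝ) ^ s) ^ f := by gcongr; exact h1.trans h2
    · have h1 : (2 : ℝ) ≤ (p : ℝ) ^ s := by
        have : (2 : ℝ) ^ (1 / s) ≤ p := (Nat.le_ceil _).trans (by exact_mod_cast not_lt.1 h)
        calc (2 : ℝ) = ((2 : ℝ) ^ (1 / s)) ^ s := by
              rw [← Real.rpow_mul two_pos.le, one_div_mul_cancel hs.ne', Real.rpow_one]
          _ ≤ _ := by gcongr
      rw [one_mul]
      calc ((f + 1 : ℕ) : ℝ) ≤ (2 : ℝ) ^ f := by exact_mod_cast Nat.lt_two_pow_self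
        _ ≤ _ := by gcongr
  refine ⟨K ^ N, by positivity, fun n hn => ?_⟩
  have hnprod : (n : ℝ) ^ s = ∏ p ∈ n.primeFactors, ((p : ℝ) ^ n.factorization p) ^ s := by
    rw [Real.finsetProd_rpow _ _ (fun _ _ => by positivity)]
    congr 1
    conv_lhs => rw [← Nat.prod_factorization_pow_eq_self hn]
    rw [Finsupp.prod, Nat.support_factorization]
    push_cast
    rfl
  rw [Nat.card_divisors hn, hnprod]
  push_cast
  calc ∏ p ∈ n.primeFactors, ((n.factorization p : ℝ) + 1)
      ≤ ∏ p ∈ n.primeFactors, ((if p < N then K else 1) * ((p : ℝ) ^ n.factorization p) ^ s) := by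
        refine prod_le_prod (fun _ _ => by positivity) fun p hp => ?_
        exact_mod_cast local_bound p (n.factorization p) (Nat.prime_of_mem_primeFactors hp)
    _ ≤ _ := by
        rw [prod_mul_distrib]
        refine mul_le_mul_of_nonneg_right ?_ (prod_nonneg fun _ _ => by positivity)
        rw [← prod_filter, prod_const]
        refine pow_le_pow_right₀ hK ?_
        calc _ ≤ #(range N) := card_le_card fun p hp => by simpa using (mem_filter.1 hp).2
          _ = N := card_range N

/-- An interval `[X, 2X]` contains at most `3X/m` multiples of `m`. -/
theorem card_filter_dvd_le {X : ℝ} {A : Finset ℤ} (hX : 0 < X)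
    (hA : ∀ a ∈ A, X ≤ (a : ℝ) ∧ (a : ℝ) ≤ 2 * X) {m : ℕ} (hm : m ≠ 0) :
    (#{a ∈ A | (m : ℤ) ∣ a} : ℝ) ≤ 3 * X / m := by
  have hm0 : (0 : ℝ) < m := by positivity
  rcases (A.filter fun a => (m : ℤ) ∣ a).eq_empty_or_nonempty with h | ⟨b, hb⟩
  · rw [h]; simp; positivity
  obtain ⟨hbA, hmb⟩ := mem_filter.1 hb
  have hb0 : 0 < b := by exact_mod_cast hX.trans_le (hA b hbA).1
  have hmX : (m : ℝ) ≤ 2 * X :=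
    le_trans (by exact_mod_cast Int.le_of_dvd hb0 hmb) (hA b hbA).2
  have hcard : #{a ∈ A | (m : ℤ) ∣ a} ≤ #(Icc ⌈X / m⌉ ⌊2 * X / m⌋) := by
    refine card_le_card_of_injOn (fun a => a / (m : ℤ)) ?_ ?_
    · intro a ha
      obtain ⟨haA, c, rfl⟩ := mem_filter.1 ha
      have := hA _ haA
      push_cast at this
      simp only [coe_Icc, Set.mem_Icc, Int.ceil_le, Int.le_floor]
      rw [Int.mul_ediv_cancel_left _ (by exact_mod_cast hm), div_le_iff₀ hm0, le_div_iff₀ hm0]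
      constructor <;> linarith
    · intro a ha c hc h
      exact Int.ediv_left_inj (mem_filter.1 ha).2 (mem_filter.1 hc).2 |>.1 h
  have hIcc : (#(Icc ⌈X / m⌉ ⌊2 * X / m⌋) : ℝ) ≤ X / m + 1 := by
    rw [Int.card_Icc]
    have h1 := Int.floor_le (2 * X / m)
    have h2 := Int.le_ceil (X / m)
    have h3 : (((⌊2 * X / m⌋ + 1 - ⌈X / m⌉).toNat : ℤ) : ℝ) ≤ X / m + 1 := by
      rw [Int.toNat_eq_max, Int.cast_max]
      refine max_le ?_ (by push_cast; positivity)
      push_cast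
      have : 2 * X / m = X / m + X / m := by ring
      linarith
    exact_mod_cast h3
  calc (#{a ∈ A | (m : ℤ) ∣ a} : ℝ) ≤ X / m + 1 := le_trans (by exact_mod_cast hcard) hIcc
    _ ≤ 3 * X / m := by
      rw [le_div_iff₀ hm0]
      have : (X / m + 1) * m = X + m := by field_simp
      linarith

/-- A weighted row-sum bound for the matrix `(1 / lcm(d, e))`. -/
theorem exists_sum_inv_lcm_mul_rpow_le {s : ℝ} (hs : 0 < s) :
    ∃ C : ℝ, 0 < C ∧ ∀ (F : Finset ℕ), (∀ e ∈ F, e ≠ 0) → ∀ d : ℕ, d ≠ 0 →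
      ∑ e ∈ F, ((d.lcm e : ℕ) : ℝ)⁻¹ * ((d : ℝ) ^ s * (e : ℝ) ^ (-s)) ≤
        C * (d : ℝ) ^ (2 * s - 1) := by
  obtain ⟨C, hC, hdiv⟩ := exists_card_divisors_le_rpow hs
  have hsum : Summable fun n : ℕ => (n : ℝ) ^ (-(1 + s)) :=
    Real.summable_nat_rpow.2 (by linarith)
  set Z := ∑' n : ℕ, (n : ℝ) ^ (-(1 + s)) with hZ
  have hZ0 : 0 < Z := hsum.tsum_pos (fun n => by positivity) 1 (by simp)
  refine ⟨Z * C, by positivity, fun F hF d hd => ?_⟩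
  have hd0 : (0 : ℝ) < d := by positivity
  have inner : ∀ c ∈ d.divisors,
      ∑ e ∈ F, (if c ∣ e then (c : ℝ) * (e : ℝ) ^ (-(1 + s)) else 0) ≤ Z := by
    intro c hc
    have hc0 : c ≠ 0 := (Nat.pos_of_mem_divisors hc).ne'
    have hc1 : (1 : ℝ) ≤ c := by exact_mod_cast Nat.one_le_iff_ne_zero.2 hc0
    rw [← sum_filter]
    calc ∑ e ∈ F with c ∣ e, (c : ℝ) * (e : ℝ) ^ (-(1 + s))
        ≤ ∑ e ∈ F with c ∣ e, ((e / c : ℕ) : ℝ) ^ (-(1 + s)) := by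
          refine sum_le_sum fun e he => ?_
          obtain ⟨heF, m, rfl⟩ := mem_filter.1 he
          rw [Nat.mul_div_cancel_left _ (Nat.pos_of_ne_zero hc0)]
          push_cast
          rw [Real.mul_rpow (by positivity) (by positivity), ← mul_assoc]
          refine mul_le_of_le_one_left (by positivity) ?_
          nth_rewrite 1 [← Real.rpow_one (c : ℝ)]
          rw [← Real.rpow_add (by positivity)]
          exact Real.rpow_le_one_of_one_le_of_nonpos hc1 (by linarith)
      _ = ∑ m ∈ image (· / c) {e ∈ F | c ∣ e}, (m : ℝ) ^ (-(1 + s)) := by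
          rw [sum_image]
          intro a ha b hb h
          exact (Nat.div_left_inj (mem_filter.1 ha).2 (mem_filter.1 hb).2).1 h
      _ ≤ Z := hsum.sum_le_tsum _ fun n _ => by positivity
  have term : ∀ e ∈ F, ((d.lcm e : ℕ) : ℝ)⁻¹ * ((d : ℝ) ^ s * (e : ℝ) ^ (-s)) ≤
      (d : ℝ) ^ (s - 1) *
        ∑ c ∈ d.divisors, (if c ∣ e then (c : ℝ) * (e : ℝ) ^ (-(1 + s)) else 0) := by
    intro e he
    have he0 : (0 : ℝ) < e := by have := hF e he; positivity
    have hg : (0 : ℝ) < (d.gcd e : ℕ) := by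
      exact_mod_cast Nat.gcd_pos_of_pos_left e (Nat.pos_of_ne_zero hd)
    have hlcm : ((d.lcm e : ℕ) : ℝ)⁻¹ = (d.gcd e : ℕ) * (d : ℝ)⁻¹ * (e : ℝ)⁻¹ := by
      have : ((d.gcd e : ℕ) : ℝ) * (d.lcm e : ℕ) = d * e := by
        exact_mod_cast Nat.gcd_mul_lcm d e
      have hl : (0 : ℝ) < (d.lcm e : ℕ) := by
        exact_mod_cast Nat.lcm_pos (Nat.pos_of_ne_zero hd) (Nat.pos_of_ne_zero (hF e he))
      field_simp
      linarith
    have hmem : d.gcd e ∈ d.divisors := Nat.mem_divisors.2 ⟨Nat.gcd_dvd_left d e, hd⟩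
    have hsingle := single_le_sum
      (f := fun c : ℕ => if c ∣ e then (c : ℝ) * (e : ℝ) ^ (-(1 + s)) else 0)
      (fun c _ => by positivity) hmem
    simp only [Nat.gcd_dvd_right, if_true] at hsingle
    refine le_trans (le_of_eq ?_) (mul_le_mul_of_nonneg_left hsingle (by positivity))
    rw [hlcm, Real.rpow_sub_one hd0.ne', neg_add, add_comm, ← sub_eq_add_neg,
      Real.rpow_sub_one he0.ne']
    ring
  calc _ ≤ ∑ e ∈ F, (d : ℝ) ^ (s - 1) *
        ∑ c ∈ d.divisors, (if c ∣ e then (c : ℝ) * (e : ℝ) ^ (-(1 + s)) else 0) :=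
        sum_le_sum term
    _ = (d : ℝ) ^ (s - 1) * ∑ c ∈ d.divisors,
        ∑ e ∈ F, (if c ∣ e then (c : ℝ) * (e : ℝ) ^ (-(1 + s)) else 0) := by
        rw [← mul_sum, sum_comm]
    _ ≤ (d : ℝ) ^ (s - 1) * ∑ c ∈ d.divisors, Z := by gcongr with c hc; exact inner c hc
    _ ≤ (d : ℝ) ^ (s - 1) * (Z * (C * (d : ℝ) ^ s)) := by
        rw [sum_const, nsmul_eq_mul, mul_comm _ Z]
        gcongr
        exact hdiv d hd
    _ = Z * C * (d : ℝ) ^ (2 * s - 1) := by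
        rw [show 2 * s - 1 = (s - 1) + s by ring, Real.rpow_add hd0]; ring

/-- A large sieve inequality for multiples: for `A ⊆ [X, 2X]`, the sum over `d ≥ D` of the
squared number of multiples of `d` in `A` is at most a constant times `X |A| D ^ (η - 1)`. -/
theorem exists_sum_card_filter_dvd_sq_le {η : ℝ} (h0 : 0 < η) (h1 : η < 1) :
    ∃ C : ℝ, 0 < C ∧ ∀ (X D : ℝ) (A : Finset ℤ) (F : Finset ℕ), 0 < X → 1 ≤ D →
      (∀ a ∈ A, X ≤ (a : ℝ) ∧ (a : ℝ) ≤ 2 * X) → (∀ d ∈ F, D ≤ (d : ℝ)) →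
      ∑ d ∈ F, (#{a ∈ A | (d : ℤ) ∣ a} : ℝ) ^ 2 ≤ C * X * #A * D ^ (η - 1) := by
  obtain ⟨C, hC, hrow⟩ := exists_sum_inv_lcm_mul_rpow_le (half_pos h0)
  refine ⟨3 * C, by positivity, fun X D A F hX hD hA hF => ?_⟩
  have hbound : 0 ≤ 3 * C * X * #A * D ^ (η - 1) := by positivity
  have hF0 : ∀ d ∈ F, d ≠ 0 := by
    rintro d hd rfl
    have := hF 0 hd
    norm_num at this
    linarith
  set g : ℕ → ℝ := fun d => (#{a ∈ A | (d : ℤ) ∣ a} : ℝ) with hg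
  have hg0 : ∀ d, 0 ≤ g d := fun d => Nat.cast_nonneg _
  have hgsum : ∀ d : ℕ, g d = ∑ a ∈ A, if (d : ℤ) ∣ a then (1 : ℝ) else 0 := fun d => by
    simp [hg]
  set S := ∑ d ∈ F, g d ^ 2 with hS
  set s := η / 2 with hs
  have dual : S = ∑ a ∈ A, ∑ d ∈ F, (if (d : ℤ) ∣ a then (1 : ℝ) else 0) * g d := by
    rw [sum_comm]
    refine sum_congr rfl fun d _ => ?_
    rw [← sum_mul, ← hgsum, sq]
  have cs : S ^ 2 ≤ #A * ∑ a ∈ A, (∑ d ∈ F, (if (d : ℤ) ∣ a then (1 : ℝ) else 0) * g d) ^ 2 := by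
    rw [dual]; exact sq_sum_le_card_mul_sum_sq
  have expand : ∑ a ∈ A, (∑ d ∈ F, (if (d : ℤ) ∣ a then (1 : ℝ) else 0) * g d) ^ 2 =
      ∑ d ∈ F, ∑ e ∈ F, g d * g e * g (d.lcm e) := by
    simp_rw [sq, sum_mul_sum]
    rw [sum_comm]
    refine sum_congr rfl fun d _ => ?_
    rw [sum_comm]
    refine sum_congr rfl fun e _ => ?_
    rw [hgsum (d.lcm e), mul_sum]
    refine sum_congr rfl fun a _ => ?_
    have : ((d.lcm e : ℕ) : ℤ) ∣ a ↔ (d : ℤ) ∣ a ∧ (e : ℤ) ∣ a := by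
      simp only [Int.natCast_dvd, Nat.lcm_dvd_iff]
    by_cases hd : (d : ℤ) ∣ a <;> by_cases he : (e : ℤ) ∣ a <;> simp [this, hd, he]
  have schur : ∑ d ∈ F, ∑ e ∈ F, g d * g e * g (d.lcm e) ≤ 3 * X * (C * D ^ (η - 1) * S) := by
    set K : ℕ → ℕ → ℝ := fun d e =>
      g d ^ 2 * (((d.lcm e : ℕ) : ℝ)⁻¹ * ((d : ℝ) ^ s * (e : ℝ) ^ (-s))) with hK
    have hpt : ∀ d ∈ F, ∀ e ∈ F, g d * g e * g (d.lcm e) ≤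
        3 * X / 2 * (K d e + K e d) := by
      intro d hd e he
      have hd0 : (0 : ℝ) < d := by have := hF0 d hd; positivity
      have he0 : (0 : ℝ) < e := by have := hF0 e he; positivity
      have hcount : g (d.lcm e) ≤ 3 * X / (d.lcm e : ℕ) :=
        card_filter_dvd_le hX hA (Nat.lcm_ne_zero (hF0 d hd) (hF0 e he))
      have hds : (0 : ℝ) < (d : ℝ) ^ s := by positivity
      have hes : (0 : ℝ) < (e : ℝ) ^ s := by positivity
      have amgm : g d * g e ≤ (g d ^ 2 * ((d : ℝ) ^ s * (e : ℝ) ^ (-s)) +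
          g e ^ 2 * ((e : ℝ) ^ s * (d : ℝ) ^ (-s))) / 2 := by
        rw [Real.rpow_neg hd0.le, Real.rpow_neg he0.le]
        have : (g d ^ 2 * ((d : ℝ) ^ s * ((e : ℝ) ^ s)⁻¹) +
            g e ^ 2 * ((e : ℝ) ^ s * ((d : ℝ) ^ s)⁻¹)) / 2 - g d * g e =
            (g d * (d : ℝ) ^ s - g e * (e : ℝ) ^ s) ^ 2 / (2 * (d : ℝ) ^ s * (e : ℝ) ^ s) := by
          field_simp
          ring
        have h' : 0 ≤ (g d * (d : ℝ) ^ s - g e * (e : ℝ) ^ s) ^ 2 /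
          (2 * (d : ℝ) ^ s * (e : ℝ) ^ s) := by positivity
        linarith
      calc g d * g e * g (d.lcm e)
          ≤ (g d ^ 2 * ((d : ℝ) ^ s * (e : ℝ) ^ (-s)) +
            g e ^ 2 * ((e : ℝ) ^ s * (d : ℝ) ^ (-s))) / 2 * (3 * X / (d.lcm e : ℕ)) :=
            mul_le_mul amgm hcount (hg0 _) (by positivity)
        _ = 3 * X / 2 * (K d e + K e d) := by
            simp only [hK]; rw [Nat.lcm_comm e d]; ring
    have hrows : ∑ d ∈ F, ∑ e ∈ F, K d e ≤ C * D ^ (η - 1) * S := by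
      rw [hS, mul_sum]
      refine sum_le_sum fun d hd => ?_
      simp only [hK]
      rw [← mul_sum, mul_comm]
      refine mul_le_mul_of_nonneg_right ?_ (by positivity)
      refine (hrow F hF0 d (hF0 d hd)).trans ?_
      rw [show 2 * (η / 2) - 1 = η - 1 by ring]
      refine mul_le_mul_of_nonneg_left ?_ hC.le
      exact Real.rpow_le_rpow_of_nonpos (by linarith) (hF d hd) (by linarith)
    calc ∑ d ∈ F, ∑ e ∈ F, g d * g e * g (d.lcm e)
        ≤ ∑ d ∈ F, ∑ e ∈ F, 3 * X / 2 * (K d e + K e d) :=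
          sum_le_sum fun d hd => sum_le_sum fun e he => hpt d hd e he
      _ = 3 * X / 2 * (∑ d ∈ F, ∑ e ∈ F, K d e + ∑ d ∈ F, ∑ e ∈ F, K e d) := by
          simp_rw [← mul_sum, sum_add_distrib]
      _ = 3 * X * ∑ d ∈ F, ∑ e ∈ F, K d e := by
          rw [sum_comm (f := fun d e => K e d)]; ring
      _ ≤ _ := by gcongr
  have hDp : 0 < D ^ (η - 1) := by positivity
  have hS0 : 0 ≤ S := sum_nonneg fun d _ => by positivity
  rcases hS0.eq_or_lt with h | h
  · rw [← h]; exact hbound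
  · refine le_of_mul_le_mul_right ?_ h
    rw [expand] at cs
    calc S * S = S ^ 2 := (sq S).symm
      _ ≤ #A * (3 * X * (C * D ^ (η - 1) * S)) := cs.trans (by gcongr)
      _ = _ := by ring

/-- Hölder's inequality for `k` functions, with both sides raised to the power `k`. -/
theorem sum_prod_pow_card_le {ι κ : Type*} [Fintype ι] [Nonempty ι] (F : Finset κ)
    (f : ι → κ → ℝ) (T : ι → ℝ) (hf : ∀ i d, 0 ≤ f i d) (hT : ∀ i, 0 < T i)
    (h : ∀ i, ∑ d ∈ F, f i d ^ Fintype.card ι ≤ T i) :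
    (∑ d ∈ F, ∏ i, f i d) ^ Fintype.card ι ≤ ∏ i, T i := by
  set k := Fintype.card ι with hk
  have hk0 : k ≠ 0 := Fintype.card_ne_zero
  have hkR : (0 : ℝ) < k := by positivity
  set r : ι → ℝ := fun i => T i ^ (1 / k : ℝ) with hr
  have hr0 : ∀ i, 0 < r i := fun i => Real.rpow_pos_of_pos (hT i) _
  have hrk : ∀ i, r i ^ k = T i := fun i => by
    simp only [hr, one_div]
    exact Real.rpow_inv_natCast_pow (hT i).le hk0
  have key : ∀ d, ∏ i, f i d ≤ (∏ i, r i) * ∑ i, (1 / k : ℝ) * (f i d ^ k / T i) := by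
    intro d
    have := Real.geom_mean_le_arith_mean_weighted univ (fun _ : ι => (1 / k : ℝ))
      (fun i => (f i d / r i) ^ k) (fun _ _ => by positivity)
      (by rw [sum_const, card_univ, nsmul_eq_mul, ← hk]; field_simp)
      (fun i _ => pow_nonneg (div_nonneg (hf i d) (hr0 i).le) k)
    have hroot : ∀ i, ((f i d / r i) ^ k) ^ (1 / k : ℝ) = f i d / r i := fun i => by
      rw [one_div]
      exact Real.pow_rpow_inv_natCast (div_nonneg (hf i d) (hr0 i).le) hk0
    simp_rw [hroot, prod_div_distrib, div_pow, hrk] at this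
    rwa [div_le_iff₀ (prod_pos fun i _ => hr0 i), mul_comm] at this
  have hle : ∑ d ∈ F, ∏ i, f i d ≤ ∏ i, r i := by
    calc ∑ d ∈ F, ∏ i, f i d
        ≤ ∑ d ∈ F, (∏ i, r i) * ∑ i, (1 / k : ℝ) * (f i d ^ k / T i) :=
          sum_le_sum fun d _ => key d
      _ = (∏ i, r i) * ∑ i, (1 / k : ℝ) * ((∑ d ∈ F, f i d ^ k) / T i) := by
          rw [← mul_sum, sum_comm]
          simp_rw [← mul_sum, sum_div]
      _ ≤ (∏ i, r i) * ∑ _i : ι, (1 / k : ℝ) * 1 := by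
          have := prod_nonneg fun i (_ : i ∈ univ) => (hr0 i).le
          gcongr with i
          exact (div_le_one (hT i)).2 (h i)
      _ = ∏ i, r i := by
          rw [sum_const, card_univ, nsmul_eq_mul, ← hk]; field_simp
  calc (∑ d ∈ F, ∏ i, f i d) ^ k ≤ (∏ i, r i) ^ k :=
        pow_le_pow_left₀ (sum_nonneg fun d _ => prod_nonneg fun i _ => hf i d) hle k
    _ = ∏ i, T i := by rw [← prod_pow]; exact prod_congr rfl fun i _ => hrk i

/-- Tuples whose gcd is at least `D` are counted by the common divisors `d ≥ D`. -/
theorem exists_card_filter_gcd_le_sum {k : ℕ} (D : ℝ) (A : Fin k → Finset ℤ) :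
    ∃ F : Finset ℕ, (∀ d ∈ F, D ≤ (d : ℝ)) ∧
      (#{a ∈ Fintype.piFinset A | D ≤ ((univ.gcd a : ℤ) : ℝ)} : ℝ) ≤
        ∑ d ∈ F, ∏ i, (#{a ∈ A i | (d : ℤ) ∣ a} : ℝ) := by
  set B := {a ∈ Fintype.piFinset A | D ≤ ((univ.gcd a : ℤ) : ℝ)} with hB
  have hgcd : ∀ a : Fin k → ℤ, (((univ.gcd a).natAbs : ℕ) : ℤ) = univ.gcd a := fun a => by
    rw [Int.natCast_natAbs, Int.abs_eq_normalize]
    exact Finset.normalize_gcd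
  refine ⟨B.image fun a => (univ.gcd a).natAbs, ?_, ?_⟩
  · intro d hd
    obtain ⟨a, ha, rfl⟩ := mem_image.1 hd
    have := (mem_filter.1 ha).2
    rw [← hgcd a] at this
    rwa [Int.cast_natCast] at this
  · have hsub : B ⊆ (B.image fun a => (univ.gcd a).natAbs).biUnion fun d : ℕ =>
        Fintype.piFinset fun i => {a ∈ A i | (d : ℤ) ∣ a} := by
      intro a ha
      refine mem_biUnion.2 ⟨_, mem_image_of_mem _ ha, ?_⟩
      rw [Fintype.mem_piFinset]
      intro i
      rw [mem_filter, hgcd]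
      exact ⟨Fintype.mem_piFinset.1 (mem_filter.1 ha).1 i, Finset.gcd_dvd (mem_univ i)⟩
    have := (card_le_card hsub).trans card_biUnion_le
    simp_rw [Fintype.card_piFinset] at this
    rw [← Nat.cast_le (α := ℝ)] at this
    simpa only [Nat.cast_sum, Nat.cast_prod] using this

/-- The `k`-th moment version of the large sieve inequality for multiples. -/
theorem exists_sum_card_filter_dvd_pow_le {η : ℝ} (h0 : 0 < η) (h1 : η < 1) {k : ℕ}
    (hk : 2 ≤ k) :
    ∃ C : ℝ, 0 < C ∧ ∀ (X D : ℝ) (A : Finset ℤ) (F : Finset ℕ), 0 < X → 1 ≤ D →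
      (∀ a ∈ A, X ≤ (a : ℝ) ∧ (a : ℝ) ≤ 2 * X) → (∀ d ∈ F, D ≤ (d : ℝ)) →
      ∑ d ∈ F, (#{a ∈ A | (d : ℤ) ∣ a} : ℝ) ^ k ≤ C * (X / D) ^ (k - 1) * #A * D ^ η := by
  obtain ⟨C, hC, hsq⟩ := exists_sum_card_filter_dvd_sq_le h0 h1
  refine ⟨3 ^ (k - 2) * C, by positivity, fun X D A F hX hD hA hF => ?_⟩
  have hD0 : 0 < D := by linarith
  obtain ⟨m, rfl⟩ := Nat.exists_eq_add_of_le' hk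
  simp only [Nat.add_sub_cancel, show m + 2 - 1 = m + 1 by omega]
  calc ∑ d ∈ F, (#{a ∈ A | (d : ℤ) ∣ a} : ℝ) ^ (m + 2)
      ≤ ∑ d ∈ F, (3 * X / D) ^ m * (#{a ∈ A | (d : ℤ) ∣ a} : ℝ) ^ 2 := by
        refine sum_le_sum fun d hd => ?_
        have hd0 : (0 : ℝ) < d := hD0.trans_le (hF d hd)
        rw [pow_add]
        gcongr
        refine (card_filter_dvd_le hX hA (by exact_mod_cast hd0.ne')).trans ?_
        have := hF d hd
        gcongr
    _ ≤ (3 * X / D) ^ m * (C * X * #A * D ^ (η - 1)) := by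
        rw [← mul_sum]
        gcongr
        exact hsq X D A F hX hD hA hF
    _ = _ := by
        rw [Real.rpow_sub_one hD0.ne', pow_succ (X / D), mul_div_assoc, mul_pow]
        ring

theorem gcd_problem_large_sieve_bound (k : ℕ) (hk : 2 ≤ k) (ε : ℝ)
    (hε : ε ∈ Set.Ioo (0:ℝ) 1) :
    ∃ C : ℝ, 0 < C ∧
      ∀ (X : Fin k → ℝ) (D δ : ℝ) (A : Fin k → Finset ℤ),
        (∀ i, 1 ≤ X i) → 1 ≤ D → (∀ i, D ≤ X i) → δ ∈ Set.Ioc (0:ℝ) 1 →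
        (∀ i, ∀ a ∈ A i, X i ≤ (a : ℝ) ∧ (a : ℝ) ≤ 2 * X i) →
        δ * ∏ i, ((A i).card : ℝ) ≤
          (((Fintype.piFinset A).filter
            (fun a => D ≤ ((Finset.univ.gcd a : ℤ) : ℝ))).card : ℝ) →
        ∏ i, ((A i).card : ℝ) ≤
          C * δ ^ (-(k : ℝ) / ((k : ℝ) - 1)) * (∏ i, X i) / D ^ ((k : ℝ) - ε) := by
  obtain ⟨hε0, hε1⟩ := hε
  have hk2 : (2 : ℝ) ≤ k := by exact_mod_cast hk
  have hk1 : (0 : ℝ) < (k : ℝ) - 1 := by linarith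
  have hcast : ((k - 1 : ℕ) : ℝ) = (k : ℝ) - 1 := by
    rw [Nat.cast_sub (by omega), Nat.cast_one]
  set η := ε * ((k : ℝ) - 1) / k with hη
  have hη0 : 0 < η := by positivity
  have hη1 : η < 1 := by
    rw [hη, div_lt_one (by positivity)]
    nlinarith
  obtain ⟨C, hC, hmom⟩ := exists_sum_card_filter_dvd_pow_le hη0 hη1 hk
  refine ⟨C ^ ((k : ℝ) / ((k : ℝ) - 1)), by positivity, ?_⟩
  intro X D δ A hX hD hDX hδ hA hcount
  have hX0 : ∀ i, 0 < X i := fun i => by linarith [hX i]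
  have hD0 : 0 < D := by linarith
  have hδ0 : 0 < δ := hδ.1
  have hQ : 0 < ∏ i, X i := prod_pos fun i _ => hX0 i
  set P := ∏ i, ((A i).card : ℝ) with hP
  have hP0 : 0 ≤ P := prod_nonneg fun _ _ => Nat.cast_nonneg _
  rcases hP0.eq_or_lt with hPz | hPpos
  · rw [← hPz]; positivity
  have hcard : ∀ i, (0 : ℝ) < #(A i) := fun i =>
    (Nat.cast_nonneg _).lt_of_ne' fun h => hPpos.ne' (prod_eq_zero (mem_univ i) h)
  obtain ⟨F, hF, hFsum⟩ := exists_card_filter_gcd_le_sum D A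
  have : Nonempty (Fin k) := ⟨⟨0, by omega⟩⟩
  have holder := sum_prod_pow_card_le F (fun i d => (#{a ∈ A i | (d : ℤ) ∣ a} : ℝ))
    (fun i => C * (X i / D) ^ (k - 1) * #(A i) * D ^ η) (fun _ _ => Nat.cast_nonneg _)
    (fun i => by have := hX0 i; have := hcard i; positivity)
    (fun i => by rw [Fintype.card_fin]; exact hmom (X i) D (A i) F (hX0 i) hD (hA i) hF)
  rw [Fintype.card_fin] at holder
  have hprod : ∏ i, C * (X i / D) ^ (k - 1) * #(A i) * D ^ η =
      C ^ k * ((∏ i, X i) / D ^ k) ^ (k - 1) * P * (D ^ η) ^ k := by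
    simp only [prod_mul_distrib, prod_const, card_univ, Fintype.card_fin, prod_pow,
      prod_div_distrib, hP]
  clear_value P
  have main : (δ * P) ^ k ≤ C ^ k * ((∏ i, X i) / D ^ k) ^ (k - 1) * P * (D ^ η) ^ k := by
    calc (δ * P) ^ k ≤ _ := pow_le_pow_left₀ (mul_nonneg hδ0.le hP0) (hcount.trans hFsum) k
      _ ≤ _ := holder
      _ = _ := hprod
  have main' : δ ^ k * P ^ (k - 1) ≤ C ^ k * ((∏ i, X i) / D ^ k) ^ (k - 1) * (D ^ η) ^ k := by
    refine le_of_mul_le_mul_right ?_ hPpos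
    calc δ ^ k * P ^ (k - 1) * P = (δ * P) ^ k := by
          rw [mul_assoc, pow_sub_one_mul (by omega), mul_pow]
      _ ≤ _ := main
      _ = _ := by ring
  refine (pow_le_pow_iff_left₀ hP0 (by positivity) (by omega : k - 1 ≠ 0)).1 ?_
  have e1 : (C ^ ((k : ℝ) / ((k : ℝ) - 1))) ^ (k - 1) = C ^ k := by
    rw [← Real.rpow_natCast, ← Real.rpow_mul hC.le, hcast, div_mul_cancel₀ _ hk1.ne',
      Real.rpow_natCast]
  have e2 : (δ ^ (-(k : ℝ) / ((k : ℝ) - 1))) ^ (k - 1) = (δ ^ k)⁻¹ := by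
    rw [← Real.rpow_natCast, ← Real.rpow_mul hδ0.le, hcast, div_mul_cancel₀ _ hk1.ne',
      Real.rpow_neg hδ0.le, Real.rpow_natCast]
  have e3 : (D ^ ε) ^ (k - 1) = (D ^ η) ^ k := by
    rw [← Real.rpow_natCast, ← Real.rpow_natCast, ← Real.rpow_mul hD0.le,
      ← Real.rpow_mul hD0.le, hcast, hη, div_mul_cancel₀ _ (by positivity)]
  have hrhs : (C ^ ((k : ℝ) / ((k : ℝ) - 1)) * δ ^ (-(k : ℝ) / ((k : ℝ) - 1)) * (∏ i, X i) /
      D ^ ((k : ℝ) - ε)) ^ (k - 1) =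
      (δ ^ k)⁻¹ * (C ^ k * ((∏ i, X i) / D ^ k) ^ (k - 1) * (D ^ η) ^ k) := by
    rw [Real.rpow_sub hD0, Real.rpow_natCast, ← e1, ← e2, ← e3]
    simp only [← mul_pow]
    congr 1
    field_simp
  rw [hrhs, le_inv_mul_iff₀ (by positivity)]
  exact main'
end

section
/- Let k ≥ 2 be an integer, let X_1, …, X_k, L ∈ [1, ∞) be real numbers with L ≥ max(X_1, …, X_k), and let δ ∈ (0,1]. Let A_1, …, A_k be finite sets of integers with A_i ⊆ [X_i, 2X_i] for each i, and suppose that the number of tuples (a_1, …, a_k) ∈ A_1 × ⋯ × A_k with lcm(a_1, …, a_k) ≤ L is at least δ·∏_{i=1}^k |A_i|. Then for every fixed ε ∈ (0,1) there is a constant C(k,ε) > 0, depending only on k and ε, such that ∏_{i=1}^k |A_i| ≤ C(k,ε) · δ^{-k/(k-1)} · L^{k/(k-1)+ε} / (∏_{i=1}^k X_i)^{1/(k-1)}. -/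
open Finset

theorem exists_add_one_le_mul_rpow_pow {ε : ℝ} (hε : 0 < ε) :
    ∃ K : ℝ, 1 ≤ K ∧ ∀ (p e : ℕ), 2 ≤ p → (e : ℝ) + 1 ≤ K * ((p : ℝ) ^ ε) ^ e := by
  have hc : 0 < ε * Real.log 2 := mul_pos hε (Real.log_pos one_lt_two)
  set c := ε * Real.log 2 with hc_def
  refine ⟨1 + 1 / c, by linarith [one_div_pos.mpr hc], fun p e hp => ?_⟩
  have h2 : 1 + c ≤ (2 : ℝ) ^ ε := by
    rw [Real.rpow_def_of_pos two_pos, mul_comm (Real.log 2)]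
    linarith [Real.add_one_le_exp c]
  have hp' : (2 : ℝ) ^ ε ≤ (p : ℝ) ^ ε :=
    Real.rpow_le_rpow zero_le_two (by exact_mod_cast hp) hε.le
  have h3 : 1 + (e : ℝ) * c ≤ ((p : ℝ) ^ ε) ^ e :=
    (one_add_mul_le_pow (by linarith) e).trans (pow_le_pow_left₀ (by linarith) (h2.trans hp') e)
  calc (e : ℝ) + 1 ≤ (1 + 1 / c) * (1 + e * c) := by
        have : (1 + 1 / c) * (1 + e * c) = 1 + e + (e * c + 1 / c) := by field_simp; ring
        rw [this]
        have : 0 ≤ e * c + 1 / c := by positivity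
        linarith
    _ ≤ _ := by gcongr

theorem Nat.exists_card_divisors_le_mul_rpow {ε : ℝ} (hε : 0 < ε) :
    ∃ C : ℝ, 0 < C ∧ ∀ n : ℕ, n ≠ 0 → ((Nat.divisors n).card : ℝ) ≤ C * (n : ℝ) ^ ε := by
  obtain ⟨K, hK, hKe⟩ := exists_add_one_le_mul_rpow_pow hε
  obtain ⟨P, hP⟩ := exists_nat_ge ((2 : ℝ) ^ (1 / ε))
  refine ⟨K ^ P, by positivity, fun n hn => ?_⟩
  have hlarge : ∀ p e : ℕ, P ≤ p → (e : ℝ) + 1 ≤ ((p : ℝ) ^ ε) ^ e := by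
    intro p e hp
    have h2 : (2 : ℝ) ≤ (p : ℝ) ^ ε := by
      calc (2 : ℝ) = ((2 : ℝ) ^ (1 / ε)) ^ ε := by
            rw [← Real.rpow_mul zero_le_two, one_div_mul_cancel hε.ne', Real.rpow_one]
        _ ≤ _ := Real.rpow_le_rpow (by positivity) (hP.trans (by exact_mod_cast hp)) hε.le
    calc (e : ℝ) + 1 ≤ (2 : ℝ) ^ e := by exact_mod_cast Nat.lt_two_pow_self
      _ ≤ _ := pow_le_pow_left₀ zero_le_two h2 e
  have hprod : ∏ p ∈ n.primeFactors, ((p : ℝ) ^ ε) ^ n.factorization p = (n : ℝ) ^ ε := by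
    conv_rhs => rw [← Nat.prod_factorization_pow_eq_self hn]
    rw [Finsupp.prod, Nat.support_factorization, Nat.cast_prod,
      ← Real.finsetProd_rpow _ _ (fun _ _ => by positivity)]
    refine prod_congr rfl fun p _ => ?_
    rw [Nat.cast_pow, ← Real.rpow_natCast, ← Real.rpow_natCast,
      ← Real.rpow_mul (by positivity), ← Real.rpow_mul (by positivity), mul_comm]
  have hconst : ∏ p ∈ n.primeFactors, (if p < P then K else 1) ≤ K ^ P := by
    rw [prod_ite, prod_const, prod_const_one, mul_one]
    refine pow_le_pow_right₀ hK ?_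
    calc _ ≤ (range P).card := card_le_card fun p hp => mem_range.2 (mem_filter.1 hp).2
      _ = P := card_range P
  calc ((Nat.divisors n).card : ℝ)
      = ∏ p ∈ n.primeFactors, ((n.factorization p : ℝ) + 1) := by
        rw [Nat.card_divisors hn]; push_cast; rfl
    _ ≤ ∏ p ∈ n.primeFactors, ((if p < P then K else 1) * ((p : ℝ) ^ ε) ^ n.factorization p) := by
        refine prod_le_prod (fun _ _ => by positivity) fun p hp => ?_
        split_ifs with h
        · exact hKe p _ (Nat.prime_of_mem_primeFactors hp).two_le
        · simpa using hlarge p _ (not_lt.1 h)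
    _ ≤ K ^ P * (n : ℝ) ^ ε := by
        rw [prod_mul_distrib, hprod]
        gcongr

/-- Tuples of positive integers whose entries all divide `n` number at most `τ(n) ^ k`. -/
theorem card_le_card_divisors_pow {k : ℕ} {n : ℕ} (hn : n ≠ 0) (S : Finset (Fin k → ℤ))
    (hS : ∀ a ∈ S, ∀ j, 0 < a j ∧ a j ∣ (n : ℤ)) : S.card ≤ (Nat.divisors n).card ^ k := by
  have hsub : S ⊆ Fintype.piFinset fun _ : Fin k =>
      (Nat.divisors n).image (fun d : ℕ => (d : ℤ)) := by
    intro a ha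
    refine Fintype.mem_piFinset.2 fun j => mem_image.2 ⟨(a j).toNat, ?_, ?_⟩
    · obtain ⟨h0, hd⟩ := hS a ha j
      refine Nat.mem_divisors.2 ⟨?_, hn⟩
      rw [← Int.natCast_dvd_natCast, Int.toNat_of_nonneg h0.le]
      exact hd
    · exact Int.toNat_of_nonneg (hS a ha j).1.le
  refine (card_le_card hsub).trans ?_
  rw [Fintype.card_piFinset_const]
  exact Nat.pow_le_pow_left card_image_le k

theorem card_filter_lcm_le {k : ℕ} (A : Fin k → Finset ℤ) {X L M : ℝ} (hX : 1 ≤ X)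
    (hL : 1 ≤ L) (hM : 0 ≤ M)
    (hpos : ∀ i, ∀ a ∈ A i, 0 < a) (i : Fin k) (hXi : ∀ a ∈ A i, X ≤ (a : ℝ))
    (hdiv : ∀ n : ℕ, n ≠ 0 → (n : ℝ) ≤ L → ((Nat.divisors n).card : ℝ) ≤ M) :
    (((Fintype.piFinset A).filter
      (fun a => ((Finset.univ.lcm a : ℤ) : ℝ) ≤ L)).card : ℝ) ≤
      M ^ k * ((A i).card * (L / X)) := by
  have hlcm : ∀ a ∈ Fintype.piFinset A, 0 < Finset.univ.lcm a := by
    intro a ha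
    have h0 : Finset.univ.lcm a ≠ 0 := by
      rw [Ne, Finset.lcm_eq_zero_iff]
      rintro ⟨j, _, hj⟩
      exact (hpos j _ (Fintype.mem_piFinset.1 ha j)).ne' hj
    have hnn : 0 ≤ Finset.univ.lcm a := by
      rw [← Finset.normalize_lcm, ← Int.abs_eq_normalize]
      exact abs_nonneg _
    exact lt_of_le_of_ne hnn h0.symm
  set S := (Fintype.piFinset A).filter (fun a => ((Finset.univ.lcm a : ℤ) : ℝ) ≤ L)
  have hmaps : ∀ a ∈ S, (a i, Finset.univ.lcm a / a i) ∈ A i ×ˢ Icc (1 : ℤ) ⌊L / X⌋ := by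
    intro a ha
    obtain ⟨ha, hle⟩ := mem_filter.1 ha
    have hai := Fintype.mem_piFinset.1 ha i
    have hd : a i ∣ Finset.univ.lcm a := Finset.dvd_lcm (mem_univ i)
    refine mem_product.2 ⟨hai, mem_Icc.2 ⟨?_, ?_⟩⟩
    · exact Int.le_ediv_of_mul_le (hpos i _ hai)
        (by simpa using Int.le_of_dvd (hlcm a ha) hd)
    · rw [Int.le_floor, le_div_iff₀ (by linarith)]
      have h1 : (((Finset.univ.lcm a / a i : ℤ)) : ℝ) * (a i : ℝ) = (Finset.univ.lcm a : ℤ) := by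
        exact_mod_cast Int.ediv_mul_cancel hd
      have h2 : (0 : ℝ) ≤ ((Finset.univ.lcm a / a i : ℤ) : ℝ) := by
        exact_mod_cast Int.ediv_nonneg (hlcm a ha).le (hpos i _ hai).le
      nlinarith [mul_le_mul_of_nonneg_left (hXi _ hai) h2]
  have hfib : ∀ b ∈ A i ×ˢ Icc (1 : ℤ) ⌊L / X⌋,
      (S.filter fun a => (a i, Finset.univ.lcm a / a i) = b).card ≤ ⌊M ^ k⌋₊ := by
    intro b _
    rcases (S.filter fun a => (a i, Finset.univ.lcm a / a i) = b).eq_empty_or_nonempty with h | h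
    · simp [h]
    have key : ∀ a ∈ S.filter fun a => (a i, Finset.univ.lcm a / a i) = b,
        a ∈ Fintype.piFinset A ∧ ((Finset.univ.lcm a : ℤ) : ℝ) ≤ L ∧
          Finset.univ.lcm a = b.1 * b.2 := by
      intro a ha
      obtain ⟨haS, rfl⟩ := mem_filter.1 ha
      obtain ⟨haA, hle⟩ := mem_filter.1 haS
      exact ⟨haA, hle, (Int.mul_ediv_cancel' (Finset.dvd_lcm (mem_univ i))).symm⟩
    obtain ⟨a₀, ha₀⟩ := h
    obtain ⟨hm₀, hle₀, he₀⟩ := key a₀ ha₀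
    have hbpos := hlcm a₀ hm₀
    obtain ⟨n, hn⟩ := Int.eq_ofNat_of_zero_le hbpos.le
    have hn0 : n ≠ 0 := by rintro rfl; simp [hn] at hbpos
    refine Nat.le_floor ?_
    calc _ ≤ (((Nat.divisors n).card ^ k : ℕ) : ℝ) := by
          refine Nat.cast_le.2 (card_le_card_divisors_pow hn0 _ fun a ha j => ?_)
          obtain ⟨hm, _, he⟩ := key a ha
          refine ⟨hpos j _ (Fintype.mem_piFinset.1 hm j), ?_⟩
          rw [← hn, he₀, ← he]
          exact Finset.dvd_lcm (mem_univ j)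
      _ ≤ M ^ k := by
          push_cast
          refine pow_le_pow_left₀ (by positivity) (hdiv n hn0 ?_) k
          rw [hn] at hle₀
          exact_mod_cast hle₀
  have hcard := card_le_mul_card_image_of_maps_to hmaps _ hfib
  have hfl : ((Icc (1 : ℤ) ⌊L / X⌋).card : ℝ) ≤ L / X := by
    have h0 : 0 ≤ ⌊L / X⌋ := Int.floor_nonneg.2 (by positivity)
    rw [Int.card_Icc, add_sub_cancel_right]
    calc ((⌊L / X⌋.toNat : ℕ) : ℝ) = ((⌊L / X⌋ : ℤ) : ℝ) := by
          exact_mod_cast Int.toNat_of_nonneg h0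
      _ ≤ L / X := Int.floor_le _
  calc (S.card : ℝ) ≤ ((⌊M ^ k⌋₊ * (A i ×ˢ Icc (1 : ℤ) ⌊L / X⌋).card : ℕ) : ℝ) := by
        exact_mod_cast hcard
    _ = (⌊M ^ k⌋₊ : ℝ) * ((A i).card * (Icc (1 : ℤ) ⌊L / X⌋).card) := by
        rw [card_product]; push_cast; rfl
    _ ≤ M ^ k * ((A i).card * (L / X)) := by
        gcongr
        exact Nat.floor_le (by positivity)

theorem lcm_problem_high_dim (k : ℕ) (hk : 2 ≤ k) (ε : ℝ) (hε : ε ∈ Set.Ioo (0:ℝ) 1) :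
    ∃ C : ℝ, 0 < C ∧
      ∀ (X : Fin k → ℝ) (L δ : ℝ) (A : Fin k → Finset ℤ),
        (∀ i, 1 ≤ X i) → 1 ≤ L → (∀ i, X i ≤ L) → δ ∈ Set.Ioc (0:ℝ) 1 →
        (∀ i, ∀ a ∈ A i, X i ≤ (a : ℝ) ∧ (a : ℝ) ≤ 2 * X i) →
        δ * ∏ i, ((A i).card : ℝ) ≤
          (((Fintype.piFinset A).filter
            (fun a => ((Finset.univ.lcm a : ℤ) : ℝ) ≤ L)).card : ℝ) →
        ∏ i, ((A i).card : ℝ) ≤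
          C * δ ^ (-(k : ℝ) / ((k : ℝ) - 1)) * L ^ ((k : ℝ) / ((k : ℝ) - 1) + ε) /
            (∏ i, X i) ^ ((1 : ℝ) / ((k : ℝ) - 1)) := by
  have hk1 : (0 : ℝ) < (k : ℝ) - 1 := by
    have : (2 : ℝ) ≤ k := by exact_mod_cast hk
    linarith
  have hk0 : (0 : ℝ) < k := by linarith
  have hη : 0 < ε * (k - 1) / k ^ 2 := by have := hε.1; positivity
  set η := ε * ((k : ℝ) - 1) / (k : ℝ) ^ 2 with hη_def
  obtain ⟨D, hD, hDdiv⟩ := Nat.exists_card_divisors_le_mul_rpow hη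
  refine ⟨D ^ ((k : ℝ) ^ 2 / (k - 1)), by positivity, fun X L δ A hX hL _ hδ hA hG => ?_⟩
  have hL0 : 0 < L := by linarith
  have hδ0 : 0 < δ := hδ.1
  have hX0 : 0 < ∏ i, X i := prod_pos fun i _ => by linarith [hX i]
  set N := ∏ i, ((A i).card : ℝ) with hN
  have hN0 : 0 ≤ N := prod_nonneg fun i _ => by positivity
  rcases hN0.eq_or_lt with h | hNpos
  · rw [← h]; positivity
  set P := ∏ i, X i with hP
  set M := D * L ^ η with hM
  have hM0 : 0 < M := by positivity
  have hdiv : ∀ n : ℕ, n ≠ 0 → (n : ℝ) ≤ L → ((Nat.divisors n).card : ℝ) ≤ M :=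
    fun n hn hnL => (hDdiv n hn).trans (by rw [hM]; gcongr)
  have hpos : ∀ i, ∀ a ∈ A i, 0 < a := fun i a ha => by
    have : (0 : ℝ) < a := by linarith [hX i, (hA i a ha).1]
    exact_mod_cast this
  have hi : ∀ i, δ * N ≤ M ^ k * ((A i).card * (L / X i)) := fun i =>
    hG.trans (card_filter_lcm_le A (hX i) hL hM0.le hpos i (fun a ha => (hA i a ha).1) hdiv)
  have hmul : (δ * N) ^ k ≤ (M ^ k) ^ k * (N * (L ^ k / P)) := by
    have hprod : ∏ _i : Fin k, (δ * N) ≤ ∏ i, (M ^ k * ((A i).card * (L / X i))) :=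
      prod_le_prod (fun _ _ => (mul_pos hδ0 hNpos).le) fun i _ => hi i
    simpa only [prod_mul_distrib, prod_div_distrib, prod_const, card_univ, Fintype.card_fin,
      ← mul_pow, ← hN, ← hP] using hprod
  clear_value N P M η
  have hlog := Real.log_le_log (by positivity) hmul
  have e1 : Real.log ((δ * N) ^ k) = k * (Real.log δ + Real.log N) := by
    rw [Real.log_pow, Real.log_mul hδ0.ne' hNpos.ne']
  have e2 : Real.log ((M ^ k) ^ k * (N * (L ^ k / P))) =
      k * (k * (Real.log D + η * Real.log L)) +
        (Real.log N + (k * Real.log L - Real.log P)) := by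
    rw [Real.log_mul (by positivity) (by positivity), Real.log_mul (by positivity) (by positivity),
      Real.log_div (by positivity) (by positivity), Real.log_pow, Real.log_pow, Real.log_pow, hM,
      Real.log_mul (by positivity) (by positivity), Real.log_rpow hL0]
  rw [e1, e2] at hlog
  rw [← Real.log_le_log_iff hNpos (by positivity), Real.log_div (by positivity) (by positivity),
    Real.log_mul (by positivity) (by positivity), Real.log_mul (by positivity) (by positivity),
    Real.log_rpow hD, Real.log_rpow hδ0, Real.log_rpow hL0, Real.log_rpow hX0]
  have e3 : (k : ℝ) * (k * (η * Real.log L)) = ε * (k - 1) * Real.log L := by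
    rw [hη_def]; field_simp
  have e4 : (k : ℝ) ^ 2 / (k - 1) * Real.log D + -(k : ℝ) / (k - 1) * Real.log δ +
      (k / (k - 1) + ε) * Real.log L - 1 / (k - 1) * Real.log P =
      (k ^ 2 * Real.log D - k * Real.log δ + k * Real.log L + ε * (k - 1) * Real.log L
        - Real.log P) / (k - 1) := by
    field_simp
    ring
  rw [e4, le_div_iff₀ hk1]
  linarith
end

section
/- Let k ≥ 3 be an integer, let q > k/(k-1) be real with conjugate exponent q' = q/(q-1), let λ ∈ (0,1), and let c ∈ (0,1]. Let μ be a finitely supported probability measure on ℤ^k, and suppose there exist nonnegative sequences x^{(1)}, …, x^{(k)} : ℤ → [0,∞) with ∑_{t∈ℤ} (x^{(i)}_t)^{q'} = 1 for each i, such that for every t = (t_1, …, t_k) ∈ ℤ^k one has μ(t) ≤ c · λ^{‖t‖_GCD} · ∏_{i=1}^k x^{(i)}_{t_i}, where ‖t‖_GCD = ∑_{i=1}^k t_i − k·min_{1≤i≤k} t_i. Then c ≥ (1/k)·(1−λ)^{k−1}. -/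
open Finset

/-- The "GCD norm" of a tuple `t ∈ ℤᵏ` (for `k > 0`):
`‖t‖_GCD = ∑ᵢ tᵢ - k · minᵢ tᵢ`. -/
def gcdNorm {k : ℕ} (hk : 0 < k) (t : Fin k → ℤ) : ℤ :=
  (∑ i, t i) - (k : ℤ) * Finset.univ.inf' (Finset.univ_nonempty_iff.mpr ⟨⟨0, hk⟩⟩) t

/-- The minimal entry of `t ∈ ℤᵏ` (for `k > 0`). -/
def minEntry {k : ℕ} (hk : 0 < k) (t : Fin k → ℤ) : ℤ :=
  Finset.univ.inf' (Finset.univ_nonempty_iff.mpr ⟨⟨0, hk⟩⟩) t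

/-- The offsets of the entries of `t` from the minimal one. -/
def offset {k : ℕ} (hk : 0 < k) (t : Fin k → ℤ) (i : Fin k) : ℕ :=
  (t i - minEntry hk t).toNat

lemma offset_cast {k : ℕ} (hk : 0 < k) (t : Fin k → ℤ) (i : Fin k) :
    (offset hk t i : ℤ) = t i - minEntry hk t :=
  Int.toNat_of_nonneg (sub_nonneg.mpr (Finset.inf'_le _ (Finset.mem_univ i)))

lemma exists_offset_eq_zero {k : ℕ} (hk : 0 < k) (t : Fin k → ℤ) : ∃ j, offset hk t j = 0 := by
  obtain ⟨j, -, hj⟩ := Finset.exists_mem_eq_inf' (Finset.univ_nonempty_iff.mpr ⟨⟨0, hk⟩⟩) t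
  refine ⟨j, ?_⟩
  simp [offset, minEntry, hj]

lemma gcdNorm_eq_sum_offset {k : ℕ} (hk : 0 < k) (t : Fin k → ℤ) :
    gcdNorm hk t = ((∑ i, offset hk t i : ℕ) : ℤ) := by
  push_cast
  simp [offset_cast, gcdNorm, minEntry]

lemma zpow_gcdNorm {k : ℕ} (hk : 0 < k) (lam : ℝ) (t : Fin k → ℤ) :
    lam ^ gcdNorm hk t = ∏ i, lam ^ offset hk t i := by
  rw [gcdNorm_eq_sum_offset, zpow_natCast, Finset.prod_pow_eq_pow_sum]

lemma apply_offset_injective {k : ℕ} (hk : 0 < k) (i : Fin k) :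
    Function.Injective fun t : Fin k → ℤ => (t i, offset hk t) := by
  intro s t h
  simp only [Prod.mk.injEq] at h
  obtain ⟨h1, h2⟩ := h
  funext j
  have hi := offset_cast hk s i
  have hj := offset_cast hk s j
  rw [h2, offset_cast] at hi hj
  linarith

lemma geom_sum_le_inv {lam : ℝ} (h0 : 0 < lam) (h1 : lam < 1) (N : ℕ) :
    ∑ n ∈ Finset.range N, lam ^ n ≤ (1 - lam)⁻¹ := by
  rw [← tsum_geometric_of_lt_one h0.le h1]
  exact (summable_geometric_of_lt_one h0.le h1).sum_le_tsum _ fun n _ => by positivity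

/-- The generating function of the vectors in `ℕᵏ` with `d j = 0` is `(1 - lam)⁻¹ ^ (k - 1)`. -/
lemma sum_prod_pow_le_of_apply_eq_zero {k : ℕ} {lam : ℝ} (h0 : 0 < lam) (h1 : lam < 1)
    (D : Finset (Fin k → ℕ)) (j : Fin k) :
    ∑ d ∈ D with d j = 0, ∏ i, lam ^ d i ≤ (1 - lam)⁻¹ ^ (k - 1) := by
  classical
  obtain ⟨N, hN⟩ : ∃ N, ∀ d ∈ D, ∀ i, d i < N := by
    refine ⟨(D.sup fun d => ∑ i, d i) + 1, fun d hd i => Nat.lt_succ_of_le ?_⟩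
    exact (Finset.single_le_sum (fun _ _ => Nat.zero_le _) (Finset.mem_univ i)).trans
      (Finset.le_sup (f := fun d : Fin k → ℕ => ∑ i, d i) hd)
  let R : Fin k → Finset ℕ := fun i => if i = j then {0} else Finset.range N
  calc ∑ d ∈ D with d j = 0, ∏ i, lam ^ d i
      ≤ ∑ d ∈ Fintype.piFinset R, ∏ i, lam ^ d i := by
        refine Finset.sum_le_sum_of_subset_of_nonneg (fun d hd => ?_)
          fun d _ _ => Finset.prod_nonneg fun i _ => by positivity
        rw [Finset.mem_filter] at hd
        rw [Fintype.mem_piFinset]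
        intro i
        by_cases hij : i = j
        · subst hij; simp [R, hd.2]
        · simpa [R, hij] using hN d hd.1 i
    _ = ∏ i, ∑ n ∈ R i, lam ^ n := (Finset.prod_univ_sum R fun _ n => lam ^ n).symm
    _ = ∏ i ∈ Finset.univ.erase j, ∑ n ∈ R i, lam ^ n := by
        rw [← Finset.mul_prod_erase _ _ (Finset.mem_univ j)]
        simp [R]
    _ ≤ ∏ i ∈ Finset.univ.erase j, (1 - lam)⁻¹ := by
        refine Finset.prod_le_prod (fun i _ => Finset.sum_nonneg fun n _ => by positivity)
          fun i hi => ?_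
        simpa [R, Finset.ne_of_mem_erase hi] using geom_sum_le_inv h0 h1 N
    _ = (1 - lam)⁻¹ ^ (k - 1) := by simp

lemma sum_prod_pow_le_of_exists_eq_zero {k : ℕ} {lam : ℝ} (h0 : 0 < lam) (h1 : lam < 1)
    (D : Finset (Fin k → ℕ)) (hD : ∀ d ∈ D, ∃ j, d j = 0) :
    ∑ d ∈ D, ∏ i, lam ^ d i ≤ k * (1 - lam)⁻¹ ^ (k - 1) := by
  classical
  have hpos : ∀ d : Fin k → ℕ, 0 ≤ ∏ i, lam ^ d i :=
    fun d => Finset.prod_nonneg fun i _ => by positivity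
  calc ∑ d ∈ D, ∏ i, lam ^ d i
      ≤ ∑ d ∈ D, ∑ j, if d j = 0 then ∏ i, lam ^ d i else 0 := by
        refine Finset.sum_le_sum fun d hd => ?_
        obtain ⟨j, hj⟩ := hD d hd
        have := Finset.single_le_sum (s := Finset.univ)
          (f := fun j => if d j = 0 then ∏ i, lam ^ d i else 0)
          (fun j _ => by split_ifs <;> simp [hpos d]) (Finset.mem_univ j)
        simpa only [hj, if_true] using this
    _ = ∑ j, ∑ d ∈ D with d j = 0, ∏ i, lam ^ d i := by
        rw [Finset.sum_comm]
        simp only [Finset.sum_filter]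
    _ ≤ ∑ _j : Fin k, (1 - lam)⁻¹ ^ (k - 1) :=
        Finset.sum_le_sum fun j _ => sum_prod_pow_le_of_apply_eq_zero h0 h1 D j
    _ = k * (1 - lam)⁻¹ ^ (k - 1) := by simp

/-- Weighting by `lam ^ ‖t‖_GCD`, a function of one coordinate of `ℓ¹`-norm at most `1` has
total mass at most `k * (1 - lam)⁻¹ ^ (k - 1)`. -/
lemma sum_zpow_gcdNorm_mul_le {k : ℕ} (hk : 0 < k) {lam : ℝ} (h0 : 0 < lam) (h1 : lam < 1)
    (S : Finset (Fin k → ℤ)) (i : Fin k) (y : ℤ → ℝ) (hy : ∀ s, 0 ≤ y s)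
    (hysum : ∀ A : Finset ℤ, ∑ s ∈ A, y s ≤ 1) :
    ∑ t ∈ S, lam ^ gcdNorm hk t * y (t i) ≤ k * (1 - lam)⁻¹ ^ (k - 1) := by
  classical
  have hpos : ∀ d : Fin k → ℕ, 0 ≤ ∏ i, lam ^ d i :=
    fun d => Finset.prod_nonneg fun i _ => by positivity
  calc ∑ t ∈ S, lam ^ gcdNorm hk t * y (t i)
      = ∑ p ∈ S.image fun t => (t i, offset hk t), y p.1 * ∏ l, lam ^ p.2 l := by
        rw [Finset.sum_image (apply_offset_injective hk i).injOn]
        exact Finset.sum_congr rfl fun t _ => by rw [zpow_gcdNorm, mul_comm]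
    _ ≤ ∑ p ∈ S.image (fun t => t i) ×ˢ S.image (offset hk), y p.1 * ∏ l, lam ^ p.2 l := by
        refine Finset.sum_le_sum_of_subset_of_nonneg (fun p hp => ?_)
          fun p _ _ => mul_nonneg (hy _) (hpos _)
        obtain ⟨t, ht, rfl⟩ := Finset.mem_image.mp hp
        exact Finset.mk_mem_product (Finset.mem_image_of_mem _ ht) (Finset.mem_image_of_mem _ ht)
    _ = (∑ s ∈ S.image fun t => t i, y s) * ∑ d ∈ S.image (offset hk), ∏ l, lam ^ d l := by
        rw [Finset.sum_product, Finset.sum_mul_sum]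
    _ ≤ 1 * ∑ d ∈ S.image (offset hk), ∏ l, lam ^ d l :=
        mul_le_mul_of_nonneg_right (hysum _) (Finset.sum_nonneg fun d _ => hpos d)
    _ ≤ k * (1 - lam)⁻¹ ^ (k - 1) := by
        rw [one_mul]
        refine sum_prod_pow_le_of_exists_eq_zero h0 h1 _ fun d hd => ?_
        obtain ⟨t, -, rfl⟩ := Finset.mem_image.mp hd
        exact exists_offset_eq_zero hk t

/-- AM-GM for the `k`-th powers of `k` nonnegative reals. -/
lemma prod_le_inv_mul_sum_pow {k : ℕ} (hk : 0 < k) (a : Fin k → ℝ) (ha : ∀ i, 0 ≤ a i) :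
    ∏ i, a i ≤ (k : ℝ)⁻¹ * ∑ i, a i ^ k := by
  have h := Real.geom_mean_le_arith_mean_weighted Finset.univ (fun _ : Fin k => (k : ℝ)⁻¹)
    (fun i => a i ^ k) (fun _ _ => by positivity)
    (by simp [hk.ne']) (fun i _ => pow_nonneg (ha i) k)
  simpa only [Real.pow_rpow_inv_natCast (ha _) hk.ne', ← Finset.mul_sum] using h

lemma sum_pow_le_one_of_tsum_rpow_eq_one {ι : Type*} {p : ℝ} {k : ℕ} (hp : 0 < p) (hpk : p ≤ k)
    (x : ι → ℝ) (hx : ∀ s, 0 ≤ x s) (hsum : ∑' s, x s ^ p = 1) (A : Finset ι) :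
    ∑ s ∈ A, x s ^ k ≤ 1 := by
  have hnonneg : ∀ s, 0 ≤ x s ^ p := fun s => Real.rpow_nonneg (hx s) p
  have hs : Summable fun s => x s ^ p := by
    by_contra h
    simp [tsum_eq_zero_of_not_summable h] at hsum
  have hle : ∀ s, x s ≤ 1 := fun s => by
    have : x s ^ p ≤ 1 := hsum ▸ hs.le_tsum s fun j _ => hnonneg j
    by_contra! h
    exact absurd this (Real.one_lt_rpow h hp).not_ge
  calc ∑ s ∈ A, x s ^ k ≤ ∑ s ∈ A, x s ^ p := by
        refine Finset.sum_le_sum fun s _ => ?_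
        rw [← Real.rpow_natCast]
        exact Real.rpow_le_rpow_of_exponent_ge_of_imp (hx s) (hle s) hpk
          fun _ h => absurd h (hp.trans_le hpk).ne'
    _ ≤ 1 := hsum ▸ hs.sum_le_tsum A fun s _ => hnonneg s

theorem measure_concentration_lower_bound_on_c
    (k : ℕ) (hk : 3 ≤ k) (q : ℝ) (hq : (k : ℝ) / ((k : ℝ) - 1) < q)
    (q' : ℝ) (hq' : q' = q / (q - 1))
    (lam : ℝ) (hlam : lam ∈ Set.Ioo (0:ℝ) 1) (c : ℝ) (hc : c ∈ Set.Ioc (0:ℝ) 1)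
    (μ : (Fin k → ℤ) →₀ ℝ) (hμ0 : ∀ t, 0 ≤ μ t) (hμ1 : ∀ t, μ t ≤ 1)
    (hμsum : ∑ t ∈ μ.support, μ t = 1)
    (x : Fin k → ℤ → ℝ) (hx0 : ∀ i t, 0 ≤ x i t)
    (hxnorm : ∀ i, ∑' t : ℤ, (x i t) ^ q' = 1)
    (hbound : ∀ t : Fin k → ℤ,
      μ t ≤ c * lam ^ gcdNorm (by omega : 0 < k) t * ∏ i, x i (t i)) :
    (1 / k : ℝ) * (1 - lam) ^ (k - 1) ≤ c := by
  obtain ⟨h0, h1⟩ := hlam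
  have hk0 : 0 < k := by omega
  have hk3 : (3 : ℝ) ≤ k := by exact_mod_cast hk
  have hkq : (k : ℝ) < q * (k - 1) := (div_lt_iff₀ (by linarith)).mp hq
  have hq1 : 1 < q := by nlinarith
  have hp0 : 0 < q' := hq' ▸ div_pos (by linarith) (by linarith)
  have hpk : q' ≤ k := by
    rw [hq', div_le_iff₀ (by linarith)]
    linarith
  set M : ℝ := k * (1 - lam)⁻¹ ^ (k - 1) with hM
  have key : (1 : ℝ) ≤ c * M := by
    calc (1 : ℝ) = ∑ t ∈ μ.support, μ t := hμsum.symm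
      _ ≤ ∑ t ∈ μ.support, c * ((k : ℝ)⁻¹ * ∑ i, lam ^ gcdNorm hk0 t * x i (t i) ^ k) := by
          refine Finset.sum_le_sum fun t _ => (hbound t).trans ?_
          rw [mul_assoc, ← Finset.mul_sum, mul_left_comm (k : ℝ)⁻¹]
          exact mul_le_mul_of_nonneg_left (mul_le_mul_of_nonneg_left
            (prod_le_inv_mul_sum_pow hk0 _ fun i => hx0 i _) (zpow_nonneg h0.le _)) hc.1.le
      _ = c * ((k : ℝ)⁻¹ * ∑ i, ∑ t ∈ μ.support, lam ^ gcdNorm hk0 t * x i (t i) ^ k) := by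
          rw [← Finset.mul_sum, ← Finset.mul_sum, Finset.sum_comm]
      _ ≤ c * ((k : ℝ)⁻¹ * ∑ _i : Fin k, M) := by
          have := hc.1.le
          gcongr with i
          exact sum_zpow_gcdNorm_mul_le hk0 h0 h1 _ i (fun s => x i s ^ k)
            (fun s => pow_nonneg (hx0 i s) k)
            (sum_pow_le_one_of_tsum_rpow_eq_one hp0 hpk (x i) (hx0 i) (hxnorm i))
      _ = c * M := by
          have : (k : ℝ) ≠ 0 := by positivity
          simp [this]
  have hMpos : 0 < M := by
    have : 0 < 1 - lam := by linarith
    positivity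
  have hMinv : (1 / k : ℝ) * (1 - lam) ^ (k - 1) = 1 / M := by
    rw [hM, inv_pow, one_div, one_div, mul_inv, inv_inv]
  rwa [hMinv, div_le_iff₀ hMpos]
end

section
/- Let k ≥ 3 be an integer and let q > k/(k-1) be real with conjugate exponent q' = q/(q-1). There exist constants λ(k) ∈ (0,1) and C(k,q) > 0 such that the following holds for every λ with 0 < λ ≤ λ(k) and every c ∈ (0,1]. Suppose μ is a finitely supported probability measure on ℤ^k and there exist nonnegative sequences x^{(1)}, …, x^{(k)} : ℤ → [0,∞) with ∑_{t∈ℤ} (x^{(i)}_t)^{q'} = 1 for each i, such that for every t = (t_1, …, t_k) ∈ ℤ^k one has μ(t) ≤ c · λ^{‖t‖_GCD} · ∏_{i=1}^k x^{(i)}_{t_i}. Then there exists an integer m ∈ ℤ such that ∑_{t ∉ 𝒮_m} μ(t) ≤ C(k,q) · λ^η, where 𝒮_m = {m·(1,…,1)} ∪ {m·(1,…,1) + e_j : 1 ≤ j ≤ k} (e_j the j-th standard basis vector of ℤ^k) and η = min{k+q−2, k(q−1), 2q−1, q+1}. -/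
open Finset

/-- The smallest coordinate of an integer tuple. -/
def minCoord {k : ℕ} [NeZero k] (t : Fin k → ℤ) : ℤ :=
  Finset.univ.inf' Finset.univ_nonempty t

/-- The excess of each coordinate of an integer tuple over the smallest one. -/
def excess {k : ℕ} [NeZero k] (t : Fin k → ℤ) (i : Fin k) : ℕ :=
  (t i - minCoord t).toNat

/-- The GCD norm as a natural number. -/
def gcdNormNat {k : ℕ} [NeZero k] (t : Fin k → ℤ) : ℕ :=
  ∑ i, excess t i

theorem coe_excess {k : ℕ} [NeZero k] (t : Fin k → ℤ) (i : Fin k) :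
    (excess t i : ℤ) = t i - minCoord t := by
  have h : minCoord t ≤ t i := Finset.inf'_le _ (Finset.mem_univ i)
  unfold excess
  omega

theorem exists_eq_minCoord {k : ℕ} [NeZero k] (t : Fin k → ℤ) : ∃ i, t i = minCoord t := by
  obtain ⟨i, -, hi⟩ := Finset.exists_mem_eq_inf' (Finset.univ_nonempty (α := Fin k)) t
  exact ⟨i, hi.symm⟩

theorem gcdNorm_eq_gcdNormNat {k : ℕ} [NeZero k] (hk : 0 < k) (t : Fin k → ℤ) :
    gcdNorm hk t = gcdNormNat t := by
  unfold gcdNorm gcdNormNat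
  push_cast
  simp only [coe_excess, Finset.sum_sub_distrib, Finset.sum_const, Finset.card_univ,
    Fintype.card_fin, nsmul_eq_mul]
  rfl

theorem eq_const_of_gcdNormNat_eq_zero {k : ℕ} [NeZero k] {t : Fin k → ℤ}
    (h : gcdNormNat t = 0) : t = fun _ => minCoord t := by
  funext i
  have h' := (Finset.sum_eq_zero_iff.mp h) i (Finset.mem_univ i)
  have := coe_excess t i
  omega

theorem sum_geom_pi_le {k : ℕ} (D : Finset (Fin k → ℕ)) :
    ∑ d ∈ D, (1 / 2 : ℝ) ^ (∑ i, d i) ≤ 2 ^ k := by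
  obtain ⟨N, hN⟩ : ∃ N, ∀ d ∈ D, ∀ i, d i < N := by
    refine ⟨D.sup (fun d => Finset.univ.sup d) + 1, fun d hd i => Nat.lt_succ_of_le ?_⟩
    exact (Finset.le_sup (f := d) (Finset.mem_univ i)).trans
      (Finset.le_sup (f := fun d : Fin k → ℕ => Finset.univ.sup d) hd)
  have hsub : D ⊆ Fintype.piFinset fun _ : Fin k => Finset.range N := by
    intro d hd
    rw [Fintype.mem_piFinset]
    exact fun i => Finset.mem_range.mpr (hN d hd i)
  calc ∑ d ∈ D, (1 / 2 : ℝ) ^ (∑ i, d i)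
      ≤ ∑ d ∈ Fintype.piFinset fun _ : Fin k => Finset.range N, (1 / 2 : ℝ) ^ (∑ i, d i) :=
        Finset.sum_le_sum_of_subset_of_nonneg hsub fun _ _ _ => by positivity
    _ = ∏ _i : Fin k, ∑ n ∈ Finset.range N, (1 / 2 : ℝ) ^ n := by
        rw [Finset.prod_univ_sum]
        exact Finset.sum_congr rfl fun d _ => (Finset.prod_pow_eq_pow_sum _ _ _).symm
    _ ≤ ∏ _i : Fin k, (2 : ℝ) :=
        Finset.prod_le_prod (fun _ _ => Finset.sum_nonneg fun _ _ => by positivity)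
          fun _ _ => sum_geometric_two_le N
    _ = 2 ^ k := by simp

/-- If `f` has sum at most `B` along every diagonal line, then its sum against the weight
`2 ^ (-‖t‖_GCD)` is at most `2 ^ k * B`. -/
theorem sum_half_pow_gcdNormNat_mul_le {k : ℕ} [NeZero k] (f : (Fin k → ℤ) → ℝ) {B : ℝ}
    (hB : 0 ≤ B)
    (hf : ∀ (d : Fin k → ℕ) (F : Finset ℤ), ∑ a ∈ F, f (fun i => a + d i) ≤ B)
    (T : Finset (Fin k → ℤ)) :
    ∑ t ∈ T, (1 / 2 : ℝ) ^ gcdNormNat t * f t ≤ 2 ^ k * B := by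
  classical
  have key : ∀ t : Fin k → ℤ, t = fun i => minCoord t + (excess t i : ℤ) := by
    intro t
    funext i
    have := coe_excess t i
    omega
  rw [← Finset.sum_fiberwise_of_maps_to (t := T.image excess) (g := excess)
    (fun t ht => Finset.mem_image_of_mem _ ht)]
  calc _ ≤ ∑ d ∈ T.image excess, (1 / 2 : ℝ) ^ (∑ i, d i) * B := by
        refine Finset.sum_le_sum fun d _ => ?_
        have hinj : Set.InjOn minCoord ((T.filter fun t => excess t = d : Finset _) :
            Set (Fin k → ℤ)) := by
          intro s hs t ht hst
          have h1 := (Finset.mem_filter.mp hs).2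
          have h2 := (Finset.mem_filter.mp ht).2
          rw [key s, key t, hst, h1, h2]
        calc ∑ t ∈ T with excess t = d, (1 / 2 : ℝ) ^ gcdNormNat t * f t
            = ∑ t ∈ T with excess t = d,
                (1 / 2 : ℝ) ^ (∑ i, d i) * f (fun i => minCoord t + d i) := by
              refine Finset.sum_congr rfl fun t ht => ?_
              have h2 := (Finset.mem_filter.mp ht).2
              subst h2
              rw [← key t]
              rfl
          _ = (1 / 2 : ℝ) ^ (∑ i, d i) *
                ∑ a ∈ (T.filter fun t => excess t = d).image minCoord, f (fun i => a + d i) := by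
              rw [← Finset.mul_sum, Finset.sum_image hinj]
          _ ≤ _ := mul_le_mul_of_nonneg_left (hf d _) (by positivity)
    _ = (∑ d ∈ T.image excess, (1 / 2 : ℝ) ^ (∑ i, d i)) * B := by rw [Finset.sum_mul]
    _ ≤ 2 ^ k * B := mul_le_mul_of_nonneg_right (sum_geom_pi_le _) hB

theorem sum_half_pow_gcdNormNat_le {k : ℕ} [NeZero k] (m : ℤ) (T : Finset (Fin k → ℤ))
    (hT : ∀ t ∈ T, ∃ i, t i = m) :
    ∑ t ∈ T, (1 / 2 : ℝ) ^ gcdNormNat t ≤ 2 ^ k * k := by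
  have h := sum_half_pow_gcdNormNat_mul_le
    (fun t : Fin k → ℤ => ∑ i, if t i = m then (1 : ℝ) else 0) (B := k) (by positivity)
    (fun d F => by
      rw [Finset.sum_comm]
      calc _ ≤ ∑ _i : Fin k, (1 : ℝ) := by
            refine Finset.sum_le_sum fun i _ => ?_
            simp_rw [← eq_sub_iff_add_eq]
            rw [Finset.sum_ite_eq']
            split_ifs <;> norm_num
        _ = k := by simp) T
  refine le_trans (Finset.sum_le_sum fun t ht => ?_) h
  obtain ⟨i, hi⟩ := hT t ht
  refine le_mul_of_one_le_right (by positivity) ?_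
  calc (1 : ℝ) = if t i = m then (1 : ℝ) else 0 := by simp [hi]
    _ ≤ _ := Finset.single_le_sum (f := fun i => if t i = m then (1 : ℝ) else 0)
      (fun j _ => by split_ifs <;> norm_num) (Finset.mem_univ i)

theorem prod_rpow_inv_card_le {k : ℕ} [NeZero k] (z : Fin k → ℝ) (hz : ∀ i, 0 ≤ z i) :
    (∏ i, z i) ^ ((k : ℝ)⁻¹) ≤ (k : ℝ)⁻¹ * ∑ i, z i := by
  have hk : (k : ℝ) ≠ 0 := NeZero.ne _
  have h := Real.geom_mean_le_arith_mean_weighted Finset.univ (fun _ : Fin k => (k : ℝ)⁻¹) z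
    (fun _ _ => by positivity) (by simp [hk]) (fun i _ => hz i)
  rwa [Real.finsetProd_rpow _ _ (fun i _ => hz i), ← Finset.mul_sum] at h

/-- Averaging the arithmetic-geometric mean inequality along a diagonal line. -/
theorem sum_inv_card_mul_sum_le {k : ℕ} [NeZero k] (y : Fin k → ℤ → ℝ) {B : ℝ}
    (hB : ∀ (i : Fin k) (F : Finset ℤ), ∑ a ∈ F, y i a ≤ B) (d : Fin k → ℤ) (F : Finset ℤ) :
    ∑ a ∈ F, (k : ℝ)⁻¹ * ∑ i, y i (a + d i) ≤ B := by
  classical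
  have hk : (k : ℝ) ≠ 0 := NeZero.ne _
  rw [← Finset.mul_sum, Finset.sum_comm]
  calc _ ≤ (k : ℝ)⁻¹ * ∑ _i : Fin k, B := by
        gcongr with i
        have := hB i (F.image fun a => a + d i)
        rwa [Finset.sum_image (fun a _ b _ h => add_right_cancel h)] at this
    _ = B := by simp [hk]

theorem sum_half_pow_gcdNormNat_mul_prod_le {k : ℕ} [NeZero k] (y : Fin k → ℤ → ℝ)
    (hy : ∀ i a, 0 ≤ y i a) {B : ℝ}
    (hB : ∀ (i : Fin k) (F : Finset ℤ), ∑ a ∈ F, y i a ^ k ≤ B) (T : Finset (Fin k → ℤ)) :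
    ∑ t ∈ T, (1 / 2 : ℝ) ^ gcdNormNat t * ∏ i, y i (t i) ≤ 2 ^ k * B := by
  refine sum_half_pow_gcdNormNat_mul_le _ (by simpa using hB 0 ∅) (fun d F => ?_) T
  refine le_trans (Finset.sum_le_sum fun a _ => ?_)
    (sum_inv_card_mul_sum_le (fun i a => y i a ^ k) hB (fun i => d i) F)
  have h := prod_rpow_inv_card_le (fun i => y i (a + d i) ^ k) (fun i => pow_nonneg (hy _ _) _)
  rwa [Finset.prod_pow, Real.pow_rpow_inv_natCast (Finset.prod_nonneg fun i _ => hy _ _)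
    (NeZero.ne k)] at h

theorem pow_le_pow_mul_half_pow {l : ℝ} (hl : 0 ≤ l) (hl2 : l ≤ 1 / 2) {n N : ℕ} (h : n ≤ N) :
    l ^ N ≤ l ^ n * 2 ^ n * (1 / 2) ^ N := by
  obtain ⟨r, rfl⟩ := Nat.exists_eq_add_of_le h
  have h1 : l ^ r ≤ (1 / 2) ^ r := pow_le_pow_left₀ hl hl2 r
  calc l ^ (n + r) = l ^ n * l ^ r := pow_add _ _ _
    _ ≤ l ^ n * (1 / 2) ^ r := by gcongr
    _ = l ^ n * 2 ^ n * (1 / 2) ^ (n + r) := by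
      rw [pow_add, mul_assoc, ← mul_assoc (2 ^ n), ← mul_pow]
      norm_num

theorem le_of_rpow_sum_le {p : ℝ} (hp : 0 < p) {y : ℤ → ℝ} (hy : ∀ a, 0 ≤ y a) {ε : ℝ}
    (hε : 0 ≤ ε) {F : Finset ℤ} (h : ∑ a ∈ F, y a ^ p ≤ ε ^ p) {a : ℤ} (ha : a ∈ F) :
    y a ≤ ε := by
  have h1 : y a ^ p ≤ ε ^ p :=
    (Finset.single_le_sum (f := fun a => y a ^ p) (fun b _ => Real.rpow_nonneg (hy b) p) ha).trans h
  exact (Real.rpow_le_rpow_iff (hy a) hε hp).mp h1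

theorem sum_pow_le_of_sum_rpow_le {k : ℕ} {p : ℝ} (hp : 0 < p) (hpk : p < k) {y : ℤ → ℝ}
    (hy : ∀ a, 0 ≤ y a) {ε : ℝ} (hε : 0 ≤ ε) {F : Finset ℤ}
    (h : ∑ a ∈ F, y a ^ p ≤ ε ^ p) : ∑ a ∈ F, y a ^ k ≤ ε ^ k := by
  have split : ∀ z : ℝ, 0 ≤ z → z ^ k = z ^ p * z ^ ((k : ℝ) - p) := by
    intro z hz
    rw [← Real.rpow_add_of_nonneg hz hp.le (by linarith), ← Real.rpow_natCast]
    congr 1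
    ring
  calc ∑ a ∈ F, y a ^ k ≤ ∑ a ∈ F, y a ^ p * ε ^ ((k : ℝ) - p) := by
        refine Finset.sum_le_sum fun a ha => ?_
        rw [split _ (hy a)]
        exact mul_le_mul_of_nonneg_left
          (Real.rpow_le_rpow (hy a) (le_of_rpow_sum_le hp hy hε h ha) (by linarith))
          (Real.rpow_nonneg (hy a) p)
    _ ≤ ε ^ p * ε ^ ((k : ℝ) - p) := by
        rw [← Finset.sum_mul]
        exact mul_le_mul_of_nonneg_right h (Real.rpow_nonneg hε _)
    _ = ε ^ k := (split ε hε).symm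

/-- Sequences that almost saturate the weighted sum are simultaneously large at one point. -/
theorem exists_lt_prod_of_one_le_sum {k : ℕ} [NeZero k] {p : ℝ} (hp : 0 < p) (hpk : p < k)
    {x : Fin k → ℤ → ℝ} (hx : ∀ i a, 0 ≤ x i a)
    (hxp : ∀ i (F : Finset ℤ), ∑ a ∈ F, x i a ^ p ≤ 1) {l : ℝ} (hl : 0 ≤ l) (hl2 : l ≤ 1 / 2)
    {S : Finset (Fin k → ℤ)} (hS : 1 ≤ ∑ t ∈ S, l ^ gcdNormNat t * ∏ i, x i (t i)) {θ : ℝ}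
    (hθ : 0 ≤ θ) (hlθ : 2 * l * 2 ^ k < 1 - θ ^ (1 - p / k)) : ∃ m, θ < ∏ i, x i m := by
  classical
  by_contra! hcon
  have hk : (0 : ℝ) < k := Nat.cast_pos.mpr (NeZero.pos k)
  have hs : 0 ≤ 1 - p / k := by
    rw [sub_nonneg, div_le_one hk]
    exact hpk.le
  have hprod : ∀ a, 0 ≤ ∏ i, x i a := fun a => Finset.prod_nonneg fun i _ => hx i a
  rw [← Finset.sum_filter_add_sum_filter_not S (fun t => gcdNormNat t = 0)] at hS
  have hdiag : ∑ t ∈ S with gcdNormNat t = 0, l ^ gcdNormNat t * ∏ i, x i (t i)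
      ≤ θ ^ (1 - p / k) := by
    have hinj : Set.InjOn minCoord ((S.filter fun t => gcdNormNat t = 0 : Finset _) :
        Set (Fin k → ℤ)) := by
      intro s hs t ht hst
      rw [eq_const_of_gcdNormNat_eq_zero (Finset.mem_filter.mp hs).2,
        eq_const_of_gcdNormNat_eq_zero (Finset.mem_filter.mp ht).2, hst]
    calc _ = ∑ t ∈ S with gcdNormNat t = 0, ∏ i, x i (minCoord t) := by
          refine Finset.sum_congr rfl fun t ht => ?_
          have h0 := (Finset.mem_filter.mp ht).2
          have h1 := eq_const_of_gcdNormNat_eq_zero h0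
          rw [h0, pow_zero, one_mul]
          exact Finset.prod_congr rfl fun i _ => by rw [← congrFun h1 i]
      _ = ∑ a ∈ (S.filter fun t => gcdNormNat t = 0).image minCoord, ∏ i, x i a := by
          rw [Finset.sum_image hinj]
      _ ≤ ∑ a ∈ (S.filter fun t => gcdNormNat t = 0).image minCoord,
            θ ^ (1 - p / k) * ((k : ℝ)⁻¹ * ∑ i, x i (a + (0 : Fin k → ℤ) i) ^ p) := by
          refine Finset.sum_le_sum fun a _ => ?_
          have h1 := prod_rpow_inv_card_le (fun i => x i a ^ p) (fun i => Real.rpow_nonneg (hx i a) p)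
          rw [Real.finsetProd_rpow _ _ (fun i _ => hx i a), ← Real.rpow_mul (hprod a),
            ← div_eq_mul_inv] at h1
          calc ∏ i, x i a = (∏ i, x i a) ^ (1 - p / k) * (∏ i, x i a) ^ (p / k) := by
                rw [← Real.rpow_add_of_nonneg (hprod a) hs (by positivity)]
                simp
            _ ≤ _ := by
                simp only [Pi.zero_apply, add_zero]
                exact mul_le_mul (Real.rpow_le_rpow (hprod a) (hcon a) hs) h1
                  (Real.rpow_nonneg (hprod a) _) (Real.rpow_nonneg hθ _)
      _ ≤ θ ^ (1 - p / k) * 1 := by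
          rw [← Finset.mul_sum]
          exact mul_le_mul_of_nonneg_left
            (sum_inv_card_mul_sum_le (fun i a => x i a ^ p) hxp 0 _) (Real.rpow_nonneg hθ _)
      _ = _ := mul_one _
  have hoff : ∑ t ∈ S with ¬ gcdNormNat t = 0, l ^ gcdNormNat t * ∏ i, x i (t i)
      ≤ 2 * l * 2 ^ k := by
    calc _ ≤ ∑ t ∈ S with ¬ gcdNormNat t = 0,
            2 * l * ((1 / 2) ^ gcdNormNat t * ∏ i, x i (t i)) := by
          refine Finset.sum_le_sum fun t ht => ?_
          have h1 : 1 ≤ gcdNormNat t := Nat.one_le_iff_ne_zero.mpr (Finset.mem_filter.mp ht).2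
          rw [← mul_assoc]
          refine mul_le_mul_of_nonneg_right ?_ (Finset.prod_nonneg fun i _ => hx i _)
          refine (pow_le_pow_mul_half_pow hl hl2 h1).trans_eq ?_
          ring
      _ ≤ 2 * l * (2 ^ k * 1) := by
          rw [← Finset.mul_sum]
          refine mul_le_mul_of_nonneg_left ?_ (by positivity)
          refine sum_half_pow_gcdNormNat_mul_prod_le x hx (fun i F => ?_) _
          simpa using sum_pow_le_of_sum_rpow_le hp hpk (hx i) zero_le_one (by simpa using hxp i F)
      _ = _ := by ring
  linarith

theorem exists_tail_bound {k : ℕ} [NeZero k] {p : ℝ} (hp : 0 < p) {x : Fin k → ℤ → ℝ}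
    (hx : ∀ i a, 0 ≤ x i a) (hxp : ∀ i (F : Finset ℤ), ∑ a ∈ F, x i a ^ p ≤ 1) (m : ℤ) :
    ∃ ε : ℝ, 0 ≤ ε ∧ (∀ i (F : Finset ℤ), m ∉ F → ∑ a ∈ F, x i a ^ p ≤ ε ^ p) ∧
      ∃ i, x i m ^ p + ε ^ p = 1 := by
  obtain ⟨i, hi⟩ := Finite.exists_min fun i => x i m
  have h1 : 0 ≤ 1 - x i m ^ p := by simpa using hxp i {m}
  refine ⟨(1 - x i m ^ p) ^ p⁻¹, Real.rpow_nonneg h1 _, fun j F hF => ?_, i, ?_⟩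
  · rw [Real.rpow_inv_rpow h1 hp.ne']
    have h2 := hxp j (insert m F)
    rw [Finset.sum_insert hF] at h2
    have h3 := Real.rpow_le_rpow (hx i m) (hi j) hp.le
    linarith
  · rw [Real.rpow_inv_rpow h1 hp.ne']
    ring

theorem prod_le_pow_card {k : ℕ} {x : Fin k → ℤ → ℝ} (hx : ∀ i a, 0 ≤ x i a) {m : ℤ} {ε : ℝ}
    (hx1 : ∀ i a, x i a ≤ 1) (hxε : ∀ i a, a ≠ m → x i a ≤ ε) (t : Fin k → ℤ) :
    ∏ i, x i (t i) ≤ ε ^ #{i | t i ≠ m} := by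
  calc ∏ i, x i (t i) ≤ ∏ i, if t i ≠ m then ε else 1 := by
        refine Finset.prod_le_prod (fun i _ => hx i _) fun i _ => ?_
        split_ifs with h
        · exact hxε i _ h
        · exact hx1 i _
    _ = _ := by rw [Finset.prod_ite]; simp

theorem sum_off_point_le {k : ℕ} [NeZero k] {p : ℝ} (hp : 0 < p) (hpk : p < k)
    {x : Fin k → ℤ → ℝ} (hx : ∀ i a, 0 ≤ x i a) {m : ℤ} {ε : ℝ} (hε : 0 ≤ ε)
    (hxε : ∀ i (F : Finset ℤ), m ∉ F → ∑ a ∈ F, x i a ^ p ≤ ε ^ p) {l : ℝ} (hl : 0 ≤ l)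
    (hl2 : l ≤ 1 / 2) (T : Finset (Fin k → ℤ)) (hT : ∀ t ∈ T, ∀ i, t i ≠ m) :
    ∑ t ∈ T, l ^ gcdNormNat t * ∏ i, x i (t i) ≤ 2 ^ k * ε ^ k := by
  classical
  refine le_trans (Finset.sum_le_sum fun t ht => ?_)
    (sum_half_pow_gcdNormNat_mul_prod_le (fun i a => if a = m then 0 else x i a)
      (fun i a => ?_) (fun i F => ?_) T)
  · refine mul_le_mul (pow_le_pow_left₀ hl hl2 _) (le_of_eq ?_)
      (Finset.prod_nonneg fun i _ => hx i _) (by positivity)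
    exact Finset.prod_congr rfl fun i _ => (if_neg (hT t ht i)).symm
  · split_ifs
    exacts [le_rfl, hx i a]
  · have h := sum_pow_le_of_sum_rpow_le hp hpk (hx i) hε (hxε i (F.erase m) (Finset.notMem_erase m F))
    refine le_trans (le_of_eq ?_) h
    rw [← Finset.filter_ne', Finset.sum_filter]
    refine Finset.sum_congr rfl fun a _ => ?_
    by_cases ham : a = m <;> simp [ham, NeZero.ne k]

/-- The total mass being one forces the tails of the sequences to be small. -/
theorem tail_rpow_le {k : ℕ} [NeZero k] {p : ℝ} (hp : 1 < p) (hpk : p < k)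
    {x : Fin k → ℤ → ℝ} (hx : ∀ i a, 0 ≤ x i a)
    (hx1 : ∀ i a, x i a ≤ 1) {m : ℤ} {ε : ℝ} (hε : 0 ≤ ε) (hε1 : ε ≤ 1)
    (hxε : ∀ i (F : Finset ℤ), m ∉ F → ∑ a ∈ F, x i a ^ p ≤ ε ^ p)
    (hm : ∃ i, x i m ^ p + ε ^ p = 1) {l : ℝ} (hl : 0 ≤ l)
    (hl2 : l ≤ 1 / 2) {S : Finset (Fin k → ℤ)}
    (hS : 1 ≤ ∑ t ∈ S, l ^ gcdNormNat t * ∏ i, x i (t i)) :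
    ε ^ p ≤ p * (2 ^ k * ε ^ k + 2 * l * ε * (2 ^ k * k)) := by
  classical
  have hp0 : 0 < p := by linarith
  have hxε' : ∀ i a, a ≠ m → x i a ≤ ε := fun i a ha =>
    le_of_rpow_sum_le hp0 (hx i) hε (hxε i {a} (by simpa using ha.symm)) (Finset.mem_singleton_self a)
  obtain ⟨i₀, hi₀⟩ := hm
  rw [← Finset.sum_filter_add_sum_filter_not S (fun t => t = fun _ => m),
    ← Finset.sum_filter_add_sum_filter_not (S.filter fun t => ¬ t = fun _ => m)
      (fun t => ∀ i, t i ≠ m)] at hS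
  have hA := sum_off_point_le hp0 hpk hx hε hxε hl hl2
    ((S.filter fun t => ¬ t = fun _ => m).filter fun t => ∀ i, t i ≠ m)
    (fun t ht => (Finset.mem_filter.mp ht).2)
  have hB : ∑ t ∈ (S.filter fun t => ¬ t = fun _ => m) with ¬ ∀ i, t i ≠ m,
      l ^ gcdNormNat t * ∏ i, x i (t i) ≤ 2 * l * ε * (2 ^ k * k) := by
    calc _ ≤ ∑ t ∈ (S.filter fun t => ¬ t = fun _ => m) with ¬ ∀ i, t i ≠ m,
            2 * l * ε * (1 / 2) ^ gcdNormNat t := by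
          refine Finset.sum_le_sum fun t ht => ?_
          obtain ⟨ht1, ht2⟩ := Finset.mem_filter.mp ht
          have htm := (Finset.mem_filter.mp ht1).2
          push Not at ht2
          obtain ⟨j, hj⟩ := ht2
          have h1 : 1 ≤ gcdNormNat t := by
            refine Nat.one_le_iff_ne_zero.mpr fun h0 => htm ?_
            have h2 := eq_const_of_gcdNormNat_eq_zero h0
            rw [h2] at hj ⊢
            rw [← hj]
          obtain ⟨j', hj'⟩ : ∃ j', t j' ≠ m := by
            by_contra! hc
            exact htm (funext hc)
          have h3 : ∏ i, x i (t i) ≤ ε := by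
            refine (prod_le_pow_card hx hx1 hxε' t).trans ?_
            refine pow_le_of_le_one hε hε1 (Finset.card_ne_zero_of_mem (a := j') ?_)
            simpa using hj'
          calc l ^ gcdNormNat t * ∏ i, x i (t i)
              ≤ (l ^ 1 * 2 ^ 1 * (1 / 2) ^ gcdNormNat t) * ε :=
                mul_le_mul (pow_le_pow_mul_half_pow hl hl2 h1) h3
                  (Finset.prod_nonneg fun i _ => hx i _) (by positivity)
            _ = _ := by ring
      _ ≤ 2 * l * ε * (2 ^ k * k) := by
          rw [← Finset.mul_sum]
          refine mul_le_mul_of_nonneg_left (sum_half_pow_gcdNormNat_le m _ fun t ht => ?_)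
            (by positivity)
          simpa using (Finset.mem_filter.mp ht).2
  have hC : ∑ t ∈ S with t = fun _ => m, l ^ gcdNormNat t * ∏ i, x i (t i) ≤ x i₀ m := by
    have hle : ∏ i, x i m ≤ x i₀ m := by
      rw [← Finset.mul_prod_erase _ _ (Finset.mem_univ i₀)]
      exact mul_le_of_le_one_right (hx _ _)
        (Finset.prod_le_one (fun i _ => hx i m) fun i _ => hx1 i m)
    calc _ ≤ ∑ t ∈ {fun _ => m}, l ^ gcdNormNat t * ∏ i, x i (t i) := by
          refine Finset.sum_le_sum_of_subset_of_nonneg (fun t ht => ?_) fun t _ _ => ?_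
          · exact Finset.mem_singleton.mpr (Finset.mem_filter.mp ht).2
          · exact mul_nonneg (pow_nonneg hl _) (Finset.prod_nonneg fun i _ => hx i _)
      _ ≤ 1 * ∏ i, x i m := by
          rw [Finset.sum_singleton]
          exact mul_le_mul_of_nonneg_right (pow_le_one₀ hl (by linarith))
            (Finset.prod_nonneg fun i _ => hx i m)
      _ ≤ _ := by rwa [one_mul]
  have hbern := one_add_mul_self_le_rpow_one_add (s := x i₀ m - 1)
    (by linarith [hx i₀ m]) hp.le
  rw [add_sub_cancel] at hbern
  have : 1 - x i₀ m ≤ 2 ^ k * ε ^ k + 2 * l * ε * (2 ^ k * k) := by linarith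
  have := mul_le_mul_of_nonneg_left this hp0.le
  linarith

theorem card_ne_and_gcdNormNat {k : ℕ} [NeZero k] {t : Fin k → ℤ} {m : ℤ} (hex : ∃ i, t i = m)
    (hne : t ≠ fun _ => m) (hup : ∀ j, t ≠ Function.update (fun _ => m) j (m + 1)) :
    1 ≤ #{i | t i ≠ m} ∧ #{i | t i ≠ m} + 1 ≤ k ∧
      (k ≤ gcdNormNat t + #{i | t i ≠ m} ∨ (#{i | t i ≠ m} = 1 ∧ 2 ≤ gcdNormNat t) ∨
        (2 ≤ #{i | t i ≠ m} ∧ #{i | t i ≠ m} ≤ gcdNormNat t)) := by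
  classical
  obtain ⟨i₀, hi₀⟩ := hex
  obtain ⟨j, hj⟩ : ∃ j, t j ≠ m := by
    by_contra! hc
    exact hne (funext hc)
  have hsum : #{i | t i = m} + #{i | t i ≠ m} = k := by
    simpa using Finset.card_filter_add_card_filter_not (s := Finset.univ) (fun i => t i = m)
  have hpos : 1 ≤ #{i | t i ≠ m} := Finset.card_pos.mpr ⟨j, by simpa using hj⟩
  have hpos' : 1 ≤ #{i | t i = m} := Finset.card_pos.mpr ⟨i₀, by simpa using hi₀⟩
  refine ⟨hpos, by omega, ?_⟩
  have hmin : minCoord t ≤ m := by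
    have := coe_excess t i₀
    omega
  rcases hmin.lt_or_eq with hlt | heq
  · left
    have : #{i | t i = m} ≤ gcdNormNat t := by
      rw [Finset.card_filter]
      refine Finset.sum_le_sum fun i _ => ?_
      have := coe_excess t i
      split_ifs <;> omega
    omega
  · right
    have hle : #{i | t i ≠ m} ≤ gcdNormNat t := by
      rw [Finset.card_filter]
      refine Finset.sum_le_sum fun i _ => ?_
      have := coe_excess t i
      split_ifs <;> omega
    rcases hpos.lt_or_eq with h2 | h1
    · exact Or.inr ⟨h2, hle⟩
    · refine Or.inl ⟨h1.symm, ?_⟩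
      have hall : ∀ i, i ≠ j → t i = m := by
        intro i hij
        by_contra hc
        exact hij (Finset.card_le_one.mp h1.symm.le i (by simpa using hc) j (by simpa using hj))
      have hj1 : t j ≠ m + 1 := by
        intro h
        refine hup j (funext fun i => ?_)
        by_cases hij : i = j
        · subst hij
          simpa using h
        · simp [hij, hall i hij]
      have h3 : excess t j ≤ gcdNormNat t :=
        Finset.single_le_sum (f := excess t) (fun _ _ => Nat.zero_le _) (Finset.mem_univ j)
      have := coe_excess t j
      omega

/-- Off the exceptional set, the decay in the GCD norm and in the sequences combine to the
claimed exponent. -/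
theorem exists_exponent_bound {k n N : ℕ} {q : ℝ} (hN : N + 1 ≤ k)
    (h : k ≤ n + N ∨ (N = 1 ∧ 2 ≤ n) ∨ (2 ≤ N ∧ N ≤ n)) (hk : 2 ≤ k) (hq : 1 < q) (hN1 : 1 ≤ N) :
    ∃ r : ℕ, r ≤ n ∧ r ≤ k ∧
      min (min ((k : ℝ) + q - 2) ((k : ℝ) * (q - 1))) (min (2 * q - 1) (q + 1))
        ≤ r + (q - 1) * N := by
  have hNk : (N : ℝ) + 1 ≤ k := by exact_mod_cast hN
  have hN1' : (1 : ℝ) ≤ N := by exact_mod_cast hN1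
  rcases h with h | ⟨h1, h2⟩ | ⟨h1, h2⟩
  · refine ⟨k - N, by omega, by omega, (min_le_left _ _).trans ?_⟩
    rw [Nat.cast_sub (by omega)]
    rcases le_total q 2 with hq2 | hq2
    · exact (min_le_right _ _).trans (by nlinarith)
    · exact (min_le_left _ _).trans (by nlinarith)
  · refine ⟨2, h2, hk, (min_le_right _ _).trans ((min_le_right _ _).trans ?_)⟩
    subst h1
    norm_num
    linarith
  · refine ⟨N, h2, by omega, (min_le_right _ _).trans ((min_le_left _ _).trans ?_)⟩
    have : (2 : ℝ) ≤ N := by exact_mod_cast h1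
    nlinarith

theorem pow_mul_le_of_exponent {k n r N : ℕ} {q η l ε K P : ℝ} (hl : 0 < l) (hl2 : l ≤ 1 / 2)
    (hε : 0 ≤ ε) (hK : 1 ≤ K) (hεK : ε ≤ K * l ^ (q - 1)) (hP0 : 0 ≤ P) (hP : P ≤ ε ^ N)
    (hrn : r ≤ n) (hrk : r ≤ k) (hNk : N ≤ k) (hη : η ≤ r + (q - 1) * N) :
    l ^ n * P ≤ 2 ^ k * K ^ k * l ^ η * (1 / 2) ^ n := by
  have h1 : P ≤ K ^ k * l ^ ((q - 1) * N) := by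
    refine hP.trans ((pow_le_pow_left₀ hε hεK N).trans ?_)
    rw [mul_pow, Real.rpow_mul_natCast hl.le]
    gcongr
  have h2 : l ^ n ≤ l ^ r * 2 ^ k * (1 / 2) ^ n := by
    refine (pow_le_pow_mul_half_pow hl.le hl2 hrn).trans ?_
    gcongr
    norm_num
  have h3 : l ^ r * l ^ ((q - 1) * N) ≤ l ^ η := by
    rw [← Real.rpow_natCast, ← Real.rpow_add hl]
    exact Real.rpow_le_rpow_of_exponent_ge hl (by linarith) hη
  calc l ^ n * P ≤ (l ^ r * 2 ^ k * (1 / 2) ^ n) * (K ^ k * l ^ ((q - 1) * N)) := by gcongr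
    _ = 2 ^ k * K ^ k * (l ^ r * l ^ ((q - 1) * N)) * (1 / 2) ^ n := by ring
    _ ≤ _ := by gcongr

theorem le_mul_rpow_of_tail {k : ℕ} {p q ε l : ℝ} (hp : 1 < p)
    (hpq : (q - 1) * (p - 1) = 1) (hε : 0 ≤ ε) (hl : 0 ≤ l)
    (hsmall : p * 2 ^ k * ε ^ ((k : ℝ) - p) ≤ 1 / 2)
    (h : ε ^ p ≤ p * (2 ^ k * ε ^ k + 2 * l * ε * (2 ^ k * k))) :
    ε ≤ (4 * p * 2 ^ k * k) ^ (q - 1) * l ^ (q - 1) := by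
  have hp0 : 0 < p := by linarith
  have hq : 0 < q - 1 := by
    by_contra! hc
    nlinarith
  rcases hε.eq_or_lt with rfl | hε'
  · exact mul_nonneg (Real.rpow_nonneg (by positivity) _) (Real.rpow_nonneg hl _)
  have hsplit : ε ^ k = ε ^ p * ε ^ ((k : ℝ) - p) := by
    rw [← Real.rpow_add hε', ← Real.rpow_natCast]
    congr 1
    ring
  have hsplit' : ε ^ p = ε ^ (p - 1) * ε := by
    rw [Real.rpow_sub_one hε'.ne', div_mul_cancel₀ _ hε'.ne']
  have h1 := mul_le_mul_of_nonneg_left hsmall (Real.rpow_nonneg hε p)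
  have h2 : ε ^ p ≤ (4 * p * 2 ^ k * k * l) * ε := by
    rw [hsplit] at h
    nlinarith
  rw [hsplit'] at h2
  have h3 := Real.rpow_le_rpow (Real.rpow_nonneg hε _) (le_of_mul_le_mul_right h2 hε') hq.le
  rwa [← Real.rpow_mul hε, mul_comm (p - 1), hpq, Real.rpow_one,
    Real.mul_rpow (by positivity) hl] at h3

/-- The thresholds for the smallness of the tails and for the parameter. -/
theorem exists_thresholds {k : ℕ} {p : ℝ} (hp : 1 < p) (hpk : p < k) :
    ∃ δ θ l₀ : ℝ, 0 < δ ∧ δ < 1 ∧ p * 2 ^ k * δ ^ ((k : ℝ) - p) ≤ 1 / 2 ∧ 0 ≤ θ ∧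
      θ ^ p = 1 - δ ^ p ∧ 0 < l₀ ∧ l₀ ≤ 1 / 2 ∧ 2 * l₀ * 2 ^ k < 1 - θ ^ (1 - p / k) := by
  have hp0 : 0 < p := by linarith
  have hkp : 0 < (k : ℝ) - p := by linarith
  have h2k : (1 : ℝ) ≤ 2 ^ k := one_le_pow₀ (by norm_num)
  have hb : 1 < 2 * p * 2 ^ k := by nlinarith
  set b : ℝ := (2 * p * 2 ^ k)⁻¹ with hbdef
  have hb0 : 0 < b := by positivity
  have hb1 : b < 1 := inv_lt_one_of_one_lt₀ hb
  set δ : ℝ := b ^ ((k : ℝ) - p)⁻¹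
  have hδ0 : 0 < δ := Real.rpow_pos_of_pos hb0 _
  have hδ1 : δ < 1 := Real.rpow_lt_one hb0.le hb1 (inv_pos.mpr hkp)
  have hδp0 : 0 < δ ^ p := Real.rpow_pos_of_pos hδ0 p
  have hδp : 0 < 1 - δ ^ p := by linarith [Real.rpow_lt_one hδ0.le hδ1 hp0]
  set θ : ℝ := (1 - δ ^ p) ^ p⁻¹
  have hθ0 : 0 ≤ θ := Real.rpow_nonneg hδp.le _
  have hθ1 : θ < 1 := Real.rpow_lt_one hδp.le (by linarith) (inv_pos.mpr hp0)
  have hs : 0 < 1 - p / k := by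
    rw [sub_pos, div_lt_one (by linarith)]
    exact hpk
  have hθs : 0 < 1 - θ ^ (1 - p / k) := by linarith [Real.rpow_lt_one hθ0 hθ1 hs]
  refine ⟨δ, θ, min (1 / 2) ((1 - θ ^ (1 - p / k)) / (4 * 2 ^ k)), hδ0, hδ1, ?_, hθ0,
    Real.rpow_inv_rpow hδp.le hp0.ne', lt_min (by norm_num) (by positivity), min_le_left _ _, ?_⟩
  · rw [Real.rpow_inv_rpow hb0.le hkp.ne', hbdef]
    apply le_of_eq
    field_simp
  · calc _ ≤ 2 * ((1 - θ ^ (1 - p / k)) / (4 * 2 ^ k)) * 2 ^ k := by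
          gcongr
          exact min_le_right _ _
      _ = (1 - θ ^ (1 - p / k)) / 2 := by
          field_simp
          norm_num
      _ < _ := by linarith

theorem conjugate_exponent_bounds {k q q' : ℝ} (hk : 1 < k) (hq : k / (k - 1) < q)
    (hq' : q' = q / (q - 1)) : 1 < q ∧ 1 < q' ∧ q' < k ∧ (q - 1) * (q' - 1) = 1 := by
  have hk' : 0 < k - 1 := by linarith
  rw [div_lt_iff₀ hk'] at hq
  have hq1 : 1 < q := by nlinarith
  have hq1' : 0 < q - 1 := by linarith
  refine ⟨hq1, ?_, ?_, ?_⟩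
  · rw [hq', one_lt_div hq1']
    linarith
  · rw [hq', div_lt_iff₀ hq1']
    linarith
  · rw [hq']
    field_simp
    ring

open Classical in
theorem measure_concentration
    (k : ℕ) (hk : 3 ≤ k) (q : ℝ) (hq : (k : ℝ) / ((k : ℝ) - 1) < q)
    (q' : ℝ) (hq' : q' = q / (q - 1)) :
    ∃ lam₀ C : ℝ, lam₀ ∈ Set.Ioo (0:ℝ) 1 ∧ 0 < C ∧
      ∀ (lam c : ℝ), 0 < lam → lam ≤ lam₀ → c ∈ Set.Ioc (0:ℝ) 1 →
      ∀ (μ : (Fin k → ℤ) →₀ ℝ), (∀ t, 0 ≤ μ t) → (∀ t, μ t ≤ 1) →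
        (∑ t ∈ μ.support, μ t = 1) →
        ∀ (x : Fin k → ℤ → ℝ), (∀ i t, 0 ≤ x i t) →
        (∀ i, ∑' t : ℤ, (x i t) ^ q' = 1) →
        (∀ t : Fin k → ℤ,
          μ t ≤ c * lam ^ gcdNorm (by omega : 0 < k) t * ∏ i, x i (t i)) →
        ∃ m : ℤ,
          ∑ t ∈ μ.support.filter (fun t =>
              ¬ (t = (fun _ => m) ∨ ∃ j, t = Function.update (fun _ => m) j (m + 1))),
            μ t ≤
          C * lam ^ min (min ((k : ℝ) + q - 2) ((k : ℝ) * (q - 1)))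
                        (min (2 * q - 1) (q + 1)) := by
  have : NeZero k := ⟨by omega⟩
  have hk3 : (3 : ℝ) ≤ k := by exact_mod_cast hk
  obtain ⟨hq1, hp, hpk, hpq⟩ := conjugate_exponent_bounds (by linarith) hq hq'
  have hp0 : 0 < q' := by linarith
  obtain ⟨δ, θ, l₀, hδ0, hδ1, hδ, hθ0, hθ, hl₀, hl₀2, hl₀θ⟩ := exists_thresholds hp hpk
  set η := min (min ((k : ℝ) + q - 2) ((k : ℝ) * (q - 1))) (min (2 * q - 1) (q + 1)) with hη
  set K : ℝ := (4 * q' * 2 ^ k * k) ^ (q - 1) with hKdef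
  have hK : 1 ≤ K := by
    refine Real.one_le_rpow ?_ (by linarith)
    have : (1 : ℝ) ≤ 2 ^ k := one_le_pow₀ (by norm_num)
    exact one_le_mul_of_one_le_of_one_le
      (one_le_mul_of_one_le_of_one_le (by linarith) this) (by linarith)
  refine ⟨l₀, 2 ^ k * K ^ k + 2 ^ k * K ^ k * (2 ^ k * k), ⟨hl₀, by linarith⟩, by positivity, ?_⟩
  intro l c hl hll₀ hc μ hμ0 hμ1 hμ x hx hxsum hμx
  have hl2 : l ≤ 1 / 2 := hll₀.trans hl₀2
  have hprod : ∀ t : Fin k → ℤ, 0 ≤ ∏ i, x i (t i) := fun t =>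
    Finset.prod_nonneg fun i _ => hx i _
  have hbound : ∀ t, μ t ≤ l ^ gcdNormNat t * ∏ i, x i (t i) := by
    intro t
    have h := hμx t
    rw [gcdNorm_eq_gcdNormNat, zpow_natCast] at h
    refine h.trans (mul_le_mul_of_nonneg_right ?_ (hprod t))
    exact mul_le_of_le_one_left (by positivity) hc.2
  have hxp : ∀ i (F : Finset ℤ), ∑ a ∈ F, x i a ^ q' ≤ 1 := by
    intro i F
    have hs : Summable fun a => x i a ^ q' := by
      by_contra hns
      have := hxsum i
      rw [tsum_eq_zero_of_not_summable hns] at this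
      exact zero_ne_one this
    rw [← hxsum i]
    exact hs.sum_le_tsum F fun a _ => Real.rpow_nonneg (hx i a) _
  have hx1 : ∀ i a, x i a ≤ 1 := fun i a =>
    le_of_rpow_sum_le hp0 (hx i) zero_le_one (by simpa using hxp i {a})
      (Finset.mem_singleton_self a)
  have hS : 1 ≤ ∑ t ∈ μ.support, l ^ gcdNormNat t * ∏ i, x i (t i) :=
    hμ.symm.le.trans (Finset.sum_le_sum fun t _ => hbound t)
  obtain ⟨m, hm⟩ := exists_lt_prod_of_one_le_sum hp0 hpk hx hxp hl.le hl2 hS hθ0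
    (lt_of_le_of_lt (by gcongr) hl₀θ)
  obtain ⟨ε, hε, hxε, i₀, hi₀⟩ := exists_tail_bound hp0 hx hxp m
  have hεδ : ε ≤ δ := by
    have h1 : θ ≤ x i₀ m := by
      refine hm.le.trans ?_
      rw [← Finset.mul_prod_erase _ _ (Finset.mem_univ i₀)]
      exact mul_le_of_le_one_right (hx _ _)
        (Finset.prod_le_one (fun i _ => hx i m) fun i _ => hx1 i m)
    have h2 := Real.rpow_le_rpow hθ0 h1 hp0.le
    exact (Real.rpow_le_rpow_iff hε hδ0.le hp0).mp (by linarith)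
  have hxε' : ∀ i a, a ≠ m → x i a ≤ ε := fun i a ha =>
    le_of_rpow_sum_le hp0 (hx i) hε (hxε i {a} (by simpa using ha.symm))
      (Finset.mem_singleton_self a)
  have hεK : ε ≤ K * l ^ (q - 1) := by
    refine le_mul_rpow_of_tail hp hpq hε hl.le (le_trans ?_ hδ)
      (tail_rpow_le hp hpk hx hx1 hε (hεδ.trans hδ1.le) hxε ⟨i₀, hi₀⟩ hl.le hl2 hS)
    exact mul_le_mul_of_nonneg_left (Real.rpow_le_rpow hε hεδ (by linarith)) (by positivity)
  refine ⟨m, (Finset.sum_le_sum fun t _ => hbound t).trans ?_⟩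
  rw [← Finset.sum_filter_add_sum_filter_not _ (fun t => ∀ i, t i ≠ m), add_mul]
  refine add_le_add ?_ ?_
  · refine (sum_off_point_le hp0 hpk hx hε hxε hl.le hl2 _
      fun t ht => (Finset.mem_filter.mp ht).2).trans ?_
    rw [mul_assoc]
    refine mul_le_mul_of_nonneg_left ?_ (by positivity)
    refine (pow_le_pow_left₀ hε hεK k).trans ?_
    rw [mul_pow, ← Real.rpow_mul_natCast hl.le]
    refine mul_le_mul_of_nonneg_left ?_ (by positivity)
    refine Real.rpow_le_rpow_of_exponent_ge hl (by linarith) ?_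
    rw [mul_comm (q - 1)]
    exact (min_le_left _ _).trans (min_le_right _ _)
  · calc _ ≤ ∑ t ∈ _, 2 ^ k * K ^ k * l ^ η * (1 / 2) ^ gcdNormNat t := by
          refine Finset.sum_le_sum fun t ht => ?_
          obtain ⟨ht1, ht2⟩ := Finset.mem_filter.mp ht
          have ht3 := (Finset.mem_filter.mp ht1).2
          push Not at ht2 ht3
          obtain ⟨hN1, hNk, hcases⟩ := card_ne_and_gcdNormNat ht2 ht3.1 ht3.2
          obtain ⟨r, hrn, hrk, hr⟩ := exists_exponent_bound hNk hcases (by omega) hq1 hN1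
          exact pow_mul_le_of_exponent hl hl2 hε hK hεK (hprod t)
            (prod_le_pow_card hx hx1 hxε' t) hrn hrk (by omega) hr
      _ ≤ 2 ^ k * K ^ k * l ^ η * (2 ^ k * k) := by
          rw [← Finset.mul_sum]
          refine mul_le_mul_of_nonneg_left (sum_half_pow_gcdNormNat_le m _ fun t ht => ?_)
            (mul_nonneg (by positivity) (Real.rpow_nonneg hl.le _))
          simpa using (Finset.mem_filter.mp ht).2
      _ = _ := by ring
end
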